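/- Let 1 ≤ k ≤ n−1 and let f : Λ^{k+1} × Λ^{k−1} → ℝ. Then f is ext-int. one affine if and only if there exist c_s ∈ Λ^{(k+1)s} for 0 ≤ s ≤ ⌊n/(k+1)⌋ and d_r ∈ Λ^{(n−k+1)r} for 0 ≤ r ≤ ⌊n/(n−k+1)⌋ such that f(ξ,η) = Σ_{s=0}^{⌊n/(k+1)⌋} ⟨c_s; ξ^s⟩ + Σ_{r=0}^{⌊n/(n−k+1)⌋} ⟨d_r; (∗η)^r⟩ for all ξ ∈ Λ^{k+1} and η ∈ Λ^{k−1}, where ξ^s denotes the s-fold exterior power ξ∧⋯∧ξ. -/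

import Mathlib

/-! Basic setup: `Λᵏ(ℝⁿ)` in coordinates with respect to the standard basis
`e^I`, `I` a strictly increasing multi-index (modeled as a `k`-element subset of
`Fin n`), together with the exterior product, interior product, inner product,
Hodge star, and the various notions of one-directional convexity/affinity. -/

/-- Increasing multi-indices of length `k` in `{1,…,n}`: `k`-element subsets of `Fin n`.
`Idx n k` plays the role of `T_k`. -/
abbrev Idx (n k : ℕ) := {s : Finset (Fin n) // s.card = k}

/-- `Λᵏ(ℝⁿ)`, identified with its coordinates in the standard basis `e^I`. -/
abbrev Lam (n k : ℕ) := Idx n k → ℝ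

/-- The sign `sgn(R,S)` defined by `e^{[R,S]} = sgn(R,S) e^R ∧ e^S` for disjoint
increasing multi-indices: `(-1)` to the number of inversions between `R` and `S`. -/
def msign {n : ℕ} (R S : Finset (Fin n)) : ℝ :=
  (-1 : ℝ) ^ (((R ×ˢ S).filter (fun p => p.2 < p.1)).card)

/-- The basis form `e^S` (of degree `k = S.card`; zero if `k ≠ S.card`). -/
def bform {n k : ℕ} (S : Finset (Fin n)) : Lam n k :=
  fun I => if I.1 = S then 1 else 0

/-- Exterior (wedge) product in coordinates.  When `m = k + l` this is the wedge
product `Λᵏ × Λˡ → Λ^{k+l}`; for other `m` it is `0`. -/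
def wedge {n k l m : ℕ} (ω : Lam n k) (φ : Lam n l) : Lam n m :=
  fun I => ∑ R : Idx n k, ∑ S : Idx n l,
    if R.1 ∪ S.1 = I.1 ∧ Disjoint R.1 S.1 then msign R.1 S.1 * (ω R * φ S) else 0

/-- Interior product `a ⌟ b`, characterized by `⟨a ⌟ b; c⟩ = ⟨b; a ∧ c⟩`.  When
`m = k - j` this is the interior product `Λʲ × Λᵏ → Λ^{k-j}`; for other `m` it is `0`. -/
def iprod {n j k m : ℕ} (a : Lam n j) (b : Lam n k) : Lam n m :=
  fun C => ∑ A : Idx n j, ∑ B : Idx n k,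
    if A.1 ∪ C.1 = B.1 ∧ Disjoint A.1 C.1 then msign A.1 C.1 * (a A * b B) else 0

/-- Hodge star with respect to the standard orientation; when `m = n - k` this is
`∗ : Λᵏ → Λ^{n-k}`. -/
def hstar {n k m : ℕ} (ω : Lam n k) : Lam n m :=
  fun J => ∑ I : Idx n k, if I.1 = (J.1)ᶜ then msign I.1 J.1 * ω I else 0

/-- Inner product `⟨·;·⟩` on `Λᵏ` (the basis `e^I` is orthonormal). -/
def ip {n k : ℕ} (ω α : Lam n k) : ℝ := ∑ I : Idx n k, ω I * α I

/-- `s`-fold exterior power `ω^s = ω ∧ ⋯ ∧ ω` (with `ω^0 = 1 ∈ Λ⁰`). -/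
def lpow {n k : ℕ} (ω : Lam n k) : (s : ℕ) → Lam n (k * s)
  | 0 => bform ∅
  | s + 1 => wedge ω (lpow ω s)

/-- `f : Λᵏ → ℝ` is ext. one convex. -/
def ExtOneConvex {n k : ℕ} (f : Lam n k → ℝ) : Prop :=
  ∀ (ω : Lam n k) (a : Lam n 1) (b : Lam n (k-1)),
    ConvexOn ℝ Set.univ (fun t : ℝ => f (ω + t • (wedge a b : Lam n k)))

/-- `f : Λᵏ → ℝ` is ext. one affine. -/
def ExtOneAffine {n k : ℕ} (f : Lam n k → ℝ) : Prop :=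
  ExtOneConvex f ∧ ExtOneConvex (fun ω => -f ω)

/-- `f : Λᵏ → ℝ` is int. one convex. -/
def IntOneConvex {n k : ℕ} (f : Lam n k → ℝ) : Prop :=
  ∀ (ω : Lam n k) (a : Lam n 1) (b : Lam n (k+1)),
    ConvexOn ℝ Set.univ (fun t : ℝ => f (ω + t • (iprod a b : Lam n k)))

/-- `f : Λᵏ → ℝ` is int. one affine. -/
def IntOneAffine {n k : ℕ} (f : Lam n k → ℝ) : Prop :=
  IntOneConvex f ∧ IntOneConvex (fun ω => -f ω)

/-- `f : Λ^{k+1} × Λ^{k-1} → ℝ` is ext-int. one convex. -/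
def ExtIntOneConvex {n k : ℕ} (f : Lam n (k+1) → Lam n (k-1) → ℝ) : Prop :=
  ∀ (ξ : Lam n (k+1)) (η : Lam n (k-1)) (a : Lam n 1) (b : Lam n k),
    ConvexOn ℝ Set.univ
      (fun t : ℝ => f (ξ + t • (wedge a b : Lam n (k+1))) (η + t • (iprod a b : Lam n (k-1))))

/-- `f : Λ^{k+1} × Λ^{k-1} → ℝ` is ext-int. one affine. -/
def ExtIntOneAffine {n k : ℕ} (f : Lam n (k+1) → Lam n (k-1) → ℝ) : Prop :=
  ExtIntOneConvex f ∧ ExtIntOneConvex (fun ξ η => -f ξ η)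

/-- `g : Λᵏ → ℝ` is affine, i.e. a constant plus a linear functional. -/
def AffineFn {n k : ℕ} (g : Lam n k → ℝ) : Prop :=
  ∃ (c : ℝ) (a : Lam n k), ∀ ω, g ω = c + ip a ω

/-! ### Functions which are affine along lines -/

/-- A function `ℝ → ℝ` of the form `t ↦ u + t v`. -/
def IsAffineLine (φ : ℝ → ℝ) : Prop := ∃ u v, ∀ t, φ t = u + t * v

lemma isAffineLine_of_convexOn {φ : ℝ → ℝ} (h₁ : ConvexOn ℝ Set.univ φ)
    (h₂ : ConvexOn ℝ Set.univ fun t => -φ t) : IsAffineLine φ := by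
  have key : ∀ x y a b : ℝ, 0 ≤ a → 0 ≤ b → a + b = 1 →
      φ (a * x + b * y) = a * φ x + b * φ y := by
    intro x y a b ha hb hab
    have e₁ := h₁.2 (Set.mem_univ x) (Set.mem_univ y) ha hb hab
    have e₂ := h₂.2 (Set.mem_univ x) (Set.mem_univ y) ha hb hab
    simp only [smul_eq_mul] at e₁ e₂
    linarith
  refine ⟨φ 0, φ 1 - φ 0, fun t => ?_⟩
  rcases lt_trichotomy t 0 with ht | rfl | ht
  · have h1 : 0 < 1 - t := by linarith
    have := key t 1 (1 / (1 - t)) (-t / (1 - t)) (by positivity)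
      (div_nonneg (by linarith) h1.le) (by field_simp; ring)
    rw [show 1 / (1 - t) * t + -t / (1 - t) * 1 = 0 by field_simp; ring] at this
    field_simp at this
    linarith
  · ring
  · rcases le_or_gt t 1 with ht1 | ht1
    · have := key 1 0 t (1 - t) ht.le (by linarith) (by ring)
      rw [show t * 1 + (1 - t) * 0 = t by ring] at this
      rw [this]; ring
    · have := key t 0 (1 / t) (1 - 1 / t) (by positivity)
        (by rw [sub_nonneg, div_le_one ht]; exact ht1.le) (by ring)
      rw [show 1 / t * t + (1 - 1 / t) * 0 = 1 by field_simp; ring] at this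
      field_simp at this
      linarith

lemma IsAffineLine.convexOn {φ : ℝ → ℝ} (h : IsAffineLine φ) : ConvexOn ℝ Set.univ φ := by
  obtain ⟨u, v, h⟩ := h
  refine ⟨convex_univ, fun x _ y _ a b _ _ hab => le_of_eq ?_⟩
  simp only [h, smul_eq_mul]
  linear_combination (-u) * hab

lemma IsAffineLine.neg {φ : ℝ → ℝ} (h : IsAffineLine φ) : IsAffineLine fun t => -φ t := by
  obtain ⟨u, v, h⟩ := h
  exact ⟨-u, -v, fun t => by simp only [h]; ring⟩

lemma IsAffineLine.add {φ ψ : ℝ → ℝ} (h : IsAffineLine φ) (h' : IsAffineLine ψ) :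
    IsAffineLine fun t => φ t + ψ t := by
  obtain ⟨u, v, h⟩ := h
  obtain ⟨u', v', h'⟩ := h'
  exact ⟨u + u', v + v', fun t => by simp only [h, h']; ring⟩

lemma IsAffineLine.sum {α : Type*} (s : Finset α) {φ : α → ℝ → ℝ}
    (h : ∀ i ∈ s, IsAffineLine (φ i)) : IsAffineLine fun t => ∑ i ∈ s, φ i t := by
  classical
  induction s using Finset.induction_on with
  | empty => exact ⟨0, 0, fun t => by simp⟩
  | insert i s hi ih =>
    simp only [Finset.sum_insert hi]
    exact (h i (by simp)).add (ih fun j hj => h j (by simp [hj]))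

lemma IsAffineLine.eq_zero_of_sq {φ : ℝ → ℝ} (h : IsAffineLine φ) {p q r : ℝ}
    (hφ : ∀ t, φ t = p + t * q + t ^ 2 * r) : r = 0 := by
  obtain ⟨u, v, h⟩ := h
  have h0 := hφ 0
  have h1 := hφ 1
  have h2 := hφ (-1)
  rw [h] at h0 h1 h2
  linarith

/-! ### Functions affine in each coordinate -/

section Separate

variable {ι : Type*} [DecidableEq ι]

/-- The partial difference of `F` in the `i`-th coordinate. -/
def pdiff (F : (ι → ℝ) → ℝ) (i : ι) (x : ι → ℝ) : ℝ := F (x + Pi.single i 1) - F x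

/-- `F` is affine in each coordinate. -/
def SepAffine (F : (ι → ℝ) → ℝ) : Prop :=
  ∀ x i t, F (x + Pi.single i t) = F x + t * pdiff F i x

lemma sepAffine_of_isAffineLine {F : (ι → ℝ) → ℝ}
    (h : ∀ x i, IsAffineLine fun t => F (x + t • Pi.single i 1)) : SepAffine F := by
  intro x i t
  obtain ⟨u, v, h⟩ := h x i
  have h0 := h 0
  have h1 := h 1
  have ht := h t
  simp only [zero_smul, add_zero, one_smul] at h0 h1
  simp only at ht
  rw [← Pi.single_smul', smul_eq_mul, mul_one] at ht
  rw [pdiff, ht, h0, h1]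
  ring

lemma SepAffine.sepAffine_pdiff {F : (ι → ℝ) → ℝ} (hF : SepAffine F) (i : ι) :
    SepAffine (pdiff F i) := by
  intro x j t
  simp only [pdiff]
  rw [add_right_comm x (Pi.single j t), hF _ j t, hF x j t, add_right_comm x (Pi.single j 1)]
  simp only [pdiff]
  ring

lemma pdiff_comm (F : (ι → ℝ) → ℝ) (i j : ι) : pdiff (pdiff F i) j = pdiff (pdiff F j) i := by
  funext x
  simp only [pdiff]
  rw [add_right_comm]
  ring

lemma SepAffine.add_two {F : (ι → ℝ) → ℝ} (hF : SepAffine F) (i j : ι) (x : ι → ℝ) (t : ℝ) :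
    F (x + Pi.single i t + Pi.single j t) =
      F x + t * (pdiff F i x + pdiff F j x)
        + t ^ 2 * pdiff (pdiff F j) i x := by
  rw [hF, hF x, (hF.sepAffine_pdiff j) x]
  ring

/-- The pure second difference in a direction along which `F` is affine vanishes. -/
lemma SepAffine.pdiff_pdiff_eq_zero {F : (ι → ℝ) → ℝ} (hF : SepAffine F) (i j : ι)
    (h : ∀ x, IsAffineLine fun t => F (x + t • (Pi.single i 1 + Pi.single j 1))) :
    pdiff (pdiff F j) i = 0 := by
  funext x
  refine (h x).eq_zero_of_sq (p := F x) (q := pdiff F i x + pdiff F j x)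
    fun t => ?_
  rw [← hF.add_two, smul_add, ← Pi.single_smul', ← Pi.single_smul', smul_eq_mul, mul_one,
    ← add_assoc]

lemma SepAffine.apply_add_of_pdiff_eq_zero {F : (ι → ℝ) → ℝ} (hF : SepAffine F) {i : ι}
    (h : pdiff F i = 0) (x : ι → ℝ) (t : ℝ) : F (x + Pi.single i t) = F x := by
  rw [hF, h]; simp

lemma SepAffine.pdiff_pdiff_add_eq_zero {F : (ι → ℝ) → ℝ} (hF : SepAffine F) (i j k l : ι)
    (hik : pdiff (pdiff F k) i = 0) (hil : pdiff (pdiff F l) i = 0)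
    (hjk : pdiff (pdiff F k) j = 0) (hjl : pdiff (pdiff F l) j = 0)
    (h : ∀ x, IsAffineLine fun t => F (x + t •
      (Pi.single i 1 + Pi.single j 1 + (Pi.single k 1 + Pi.single l 1)))) (x : ι → ℝ) :
    pdiff (pdiff F j) i x + pdiff (pdiff F l) k x = 0 := by
  refine (h x).eq_zero_of_sq (p := F x) (q := pdiff F i x + pdiff F j x +
    (pdiff F k x + pdiff F l x)) fun t => ?_
  have e : x + t • (Pi.single i (1 : ℝ) + Pi.single j 1 + (Pi.single k 1 + Pi.single l 1)) =
      x + Pi.single i t + Pi.single j t + Pi.single k t + Pi.single l t := by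
    simp only [smul_add, ← Pi.single_smul', smul_eq_mul, mul_one, add_assoc]
  have hlk : ∀ r : ι, pdiff (pdiff F l) r = 0 →
      pdiff (pdiff (pdiff F l) k) r = 0 := by
    intro r hr
    rw [pdiff_comm, hr]
    funext y
    simp [pdiff]
  rw [e, hF.add_two, (hF.sepAffine_pdiff k).apply_add_of_pdiff_eq_zero hjk,
    (hF.sepAffine_pdiff k).apply_add_of_pdiff_eq_zero hik,
    (hF.sepAffine_pdiff l).apply_add_of_pdiff_eq_zero hjl,
    (hF.sepAffine_pdiff l).apply_add_of_pdiff_eq_zero hil,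
    ((hF.sepAffine_pdiff l).sepAffine_pdiff k).apply_add_of_pdiff_eq_zero (hlk j hjl),
    ((hF.sepAffine_pdiff l).sepAffine_pdiff k).apply_add_of_pdiff_eq_zero (hlk i hil), hF.add_two]
  ring

/-- The coefficient of the monomial `∏ i ∈ A, x i` of a function affine in each coordinate. -/
def mcoef (F : (ι → ℝ) → ℝ) (A : Finset ι) : ℝ :=
  ∑ B ∈ A.powerset, (-1) ^ (A \ B).card * F (∑ i ∈ B, Pi.single i 1)

lemma mcoef_insert (F : (ι → ℝ) → ℝ) {i : ι} {A : Finset ι} (hi : i ∉ A) :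
    mcoef F (insert i A) = mcoef (pdiff F i) A := by
  rw [mcoef, Finset.sum_powerset_insert hi, mcoef, ← Finset.sum_add_distrib]
  refine Finset.sum_congr rfl fun B hB => ?_
  rw [Finset.mem_powerset] at hB
  have hiB : i ∉ B := fun h => hi (hB h)
  rw [Finset.insert_sdiff_of_notMem _ hiB, Finset.card_insert_of_notMem (by simp [hi]),
    Finset.insert_sdiff_insert, Finset.sdiff_insert_of_notMem hi, Finset.sum_insert hiB, pdiff,
    add_comm (Pi.single i _)]
  ring

lemma SepAffine.eq_sum {F : (ι → ℝ) → ℝ} (hF : SepAffine F) (U : Finset ι) (x : ι → ℝ)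
    (hx : ∀ i ∉ U, x i = 0) :
    F x = ∑ A ∈ U.powerset, mcoef F A * ∏ i ∈ A, x i := by
  induction U using Finset.induction_on generalizing F x with
  | empty =>
    have : x = 0 := funext fun i => hx i (by simp)
    simp [mcoef, this]
  | insert i U hi ih =>
    set y := Function.update x i 0 with hy
    have hxy : x = y + Pi.single i (x i) := by
      funext j
      rcases eq_or_ne j i with rfl | h <;> simp [*]
    have hyU : ∀ j ∉ U, y j = 0 := by
      intro j hj
      rcases eq_or_ne j i with rfl | h
      · simp [hy]
      · simpa [hy, h] using hx j (by simp [h, hj])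
    have hprod : ∀ A ∈ U.powerset, ∏ j ∈ A, y j = ∏ j ∈ A, x j := by
      intro A hA
      refine Finset.prod_congr rfl fun j hj => ?_
      have : j ≠ i := by rintro rfl; exact hi (Finset.mem_powerset.1 hA hj)
      simp [hy, this]
    rw [Finset.sum_powerset_insert hi]
    conv_lhs => rw [hxy]
    rw [hF, ih hF y hyU, ih (hF.sepAffine_pdiff i) y hyU, Finset.mul_sum]
    congr 1
    · exact Finset.sum_congr rfl fun A hA => by rw [hprod A hA]
    · refine Finset.sum_congr rfl fun A hA => ?_
      have hiA : i ∉ A := fun h => hi (Finset.mem_powerset.1 hA h)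
      rw [hprod A hA, mcoef_insert F hiA, Finset.prod_insert hiA]
      ring

lemma eq_apply_zero_of_single_invariant [Fintype ι] {X : Type*} {h : (ι → ℝ) → X}
    (hh : ∀ x i t, h (x + Pi.single i t) = h x) (x : ι → ℝ) : h x = h 0 := by
  have : ∀ U : Finset ι, h (∑ i ∈ U, Pi.single i (x i)) = h 0 := by
    intro U
    induction U using Finset.induction_on with
    | empty => simp
    | insert i U hi ih => rw [Finset.sum_insert hi, add_comm, hh, ih]
  rw [← this Finset.univ, Finset.univ_sum_single]

end Separate

lemma sum_injective_image_eq {ι : Type*} [Fintype ι] [DecidableEq ι] (s : ℕ)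
    (G : Finset ι → ℝ) :
    ∑ g : Fin s → ι, (if Function.Injective g then G (Finset.univ.image g) else 0) =
      s.factorial * ∑ A ∈ Finset.powersetCard s Finset.univ, G A := by
  classical
  rw [← Finset.sum_filter, Finset.mul_sum]
  have hmap : ∀ g ∈ (Finset.univ.filter fun g : Fin s → ι => Function.Injective g),
      Finset.univ.image g ∈ Finset.powersetCard s (Finset.univ : Finset ι) := by
    intro g hg
    rw [Finset.mem_filter] at hg
    simp [Finset.mem_powersetCard, Finset.card_image_of_injective _ hg.2]
  rw [← Finset.sum_fiberwise_of_maps_to hmap]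
  refine Finset.sum_congr rfl fun A hA => ?_
  rw [Finset.sum_congr rfl (g := fun _ => G A) (by
    intro g hg; rw [(Finset.mem_filter.1 hg).2]), Finset.sum_const, nsmul_eq_mul]
  congr 2
  have hAc := (Finset.mem_powersetCard.1 hA).2
  have e : Fin s ≃ A := (Fintype.equivFinOfCardEq (by simpa using hAc)).symm
  have hc : Fintype.card (Fin s ≃ A) = s.factorial := by
    rw [Fintype.card_equiv e, Fintype.card_fin]
  rw [← hc, ← Finset.card_univ]
  symm
  refine Finset.card_bij (fun φ _ j => (φ j : ι)) ?_ ?_ ?_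
  · intro φ _
    simp only [Finset.mem_filter, Finset.mem_univ, true_and]
    refine ⟨Subtype.val_injective.comp φ.injective, ?_⟩
    ext a
    simp only [Finset.mem_image, Finset.mem_univ, true_and]
    constructor
    · rintro ⟨j, rfl⟩; exact (φ j).2
    · intro ha; exact ⟨φ.symm ⟨a, ha⟩, by simp⟩
  · intro φ _ ψ _ h
    ext j
    exact congrFun h j
  · intro g hg
    simp only [Finset.mem_filter, Finset.mem_univ, true_and] at hg
    obtain ⟨hinj, him⟩ := hg
    have hmem : ∀ j, g j ∈ A := fun j => him ▸ Finset.mem_image_of_mem g (Finset.mem_univ j)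
    refine ⟨Equiv.ofBijective (fun j => ⟨g j, hmem j⟩) ⟨?_, ?_⟩, Finset.mem_univ _, rfl⟩
    · intro i j hij
      exact hinj (congrArg Subtype.val hij)
    · rintro ⟨a, ha⟩
      rw [← him] at ha
      obtain ⟨j, _, rfl⟩ := Finset.mem_image.1 ha
      exact ⟨j, rfl⟩

/-! ### Signs -/

section Signs

variable {n : ℕ}

lemma msign_eq_prod (R S : Finset (Fin n)) :
    msign R S = ∏ x ∈ R, ∏ y ∈ S, if y < x then (-1 : ℝ) else 1 := by
  rw [← Finset.prod_product', Finset.prod_ite]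
  simp [msign]

lemma msign_mul_self (R S : Finset (Fin n)) : msign R S * msign R S = 1 := by
  rw [msign, ← mul_pow]; simp

lemma msign_union_left {R S : Finset (Fin n)} (T : Finset (Fin n)) (h : Disjoint R S) :
    msign (R ∪ S) T = msign R T * msign S T := by
  simp only [msign_eq_prod, Finset.prod_union h]

lemma msign_union_right (T : Finset (Fin n)) {R S : Finset (Fin n)} (h : Disjoint R S) :
    msign T (R ∪ S) = msign T R * msign T S := by
  simp only [msign_eq_prod, Finset.prod_union h, Finset.prod_mul_distrib]

lemma msign_swap {R S : Finset (Fin n)} (h : Disjoint R S) :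
    msign R S = (-1) ^ (R.card * S.card) * msign S R := by
  have : msign R S * msign S R = (-1) ^ (R.card * S.card) := by
    rw [msign_eq_prod, msign_eq_prod S R, Finset.prod_comm (s := S), ← Finset.prod_mul_distrib]
    simp_rw [← Finset.prod_mul_distrib]
    rw [Finset.prod_congr rfl (g := fun _ => (-1 : ℝ) ^ S.card)]
    · rw [Finset.prod_const, ← pow_mul, mul_comm]
    · intro x hx
      rw [Finset.prod_congr rfl (g := fun _ => (-1 : ℝ)), Finset.prod_const]
      intro y hy
      have hxy : x ≠ y := fun e => Finset.disjoint_left.1 h hx (e ▸ hy)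
      rcases lt_or_gt_of_ne hxy with h' | h' <;> simp [h', not_lt_of_gt h']
  rw [← this, mul_assoc, msign_mul_self, mul_one]

end Signs

/-! ### The exterior algebra in coordinates indexed by all subsets -/

section Flat

variable {n : ℕ}

/-- Structure constants of the exterior product. -/
def wcoef (R S I : Finset (Fin n)) : ℝ :=
  if R ∪ S = I ∧ Disjoint R S then msign R S else 0

/-- The exterior product on inhomogeneous forms. -/
def fmul (x y : Finset (Fin n) → ℝ) : Finset (Fin n) → ℝ :=
  fun I => ∑ R, ∑ S, wcoef R S I * (x R * y S)

/-- A homogeneous form viewed as an inhomogeneous one. -/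
def flat {k : ℕ} (ω : Lam n k) : Finset (Fin n) → ℝ :=
  fun S => if h : S.card = k then ω ⟨S, h⟩ else 0

/-- The parity involution. -/
def invol (x : Finset (Fin n) → ℝ) : Finset (Fin n) → ℝ :=
  fun S => (-1) ^ S.card * x S

lemma sum_wcoef_mul (R S : Finset (Fin n)) (G : Finset (Fin n) → ℝ) :
    ∑ U, wcoef R S U * G U = if Disjoint R S then msign R S * G (R ∪ S) else 0 := by
  rw [Finset.sum_eq_single (R ∪ S)]
  · by_cases h : Disjoint R S <;> simp [wcoef, h]
  · intro U _ hU
    simp [wcoef, hU.symm]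
  · simp

lemma sum_wcoef_mul_wcoef (R S T I : Finset (Fin n)) :
    ∑ U, wcoef R S U * wcoef U T I = ∑ V, wcoef S T V * wcoef R V I := by
  rw [sum_wcoef_mul, sum_wcoef_mul]
  unfold wcoef
  by_cases hRS : Disjoint R S
  · by_cases hST : Disjoint S T
    · by_cases hRT : Disjoint R T
      · simp only [hRS, hST, hRT, Finset.disjoint_union_left, Finset.disjoint_union_right,
          and_true, if_true, Finset.union_assoc, msign_union_left _ hRS,
          msign_union_right _ hST]
        split_ifs <;> ring
      · simp [hRT]
    · simp [hST]
  · simp [hRS]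

lemma fmul_assoc (x y z : Finset (Fin n) → ℝ) : fmul (fmul x y) z = fmul x (fmul y z) := by
  funext I
  have h₁ : fmul (fmul x y) z I =
      ∑ R, ∑ S, ∑ T, (∑ U, wcoef R S U * wcoef U T I) * (x R * y S * z T) := by
    simp only [fmul, Finset.sum_mul, Finset.mul_sum]
    rw [Finset.sum_comm]
    calc _ = ∑ T, ∑ R, ∑ S, ∑ U, wcoef R S U * wcoef U T I * (x R * y S * z T) := by
          refine Finset.sum_congr rfl fun T _ => ?_
          rw [Finset.sum_comm]
          refine Finset.sum_congr rfl fun R _ => ?_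
          rw [Finset.sum_comm]
          refine Finset.sum_congr rfl fun S _ => Finset.sum_congr rfl fun U _ => by ring
      _ = _ := by
          rw [Finset.sum_comm]
          exact Finset.sum_congr rfl fun R _ => Finset.sum_comm
  have h₂ : fmul x (fmul y z) I =
      ∑ R, ∑ S, ∑ T, (∑ V, wcoef S T V * wcoef R V I) * (x R * y S * z T) := by
    simp only [fmul, Finset.sum_mul, Finset.mul_sum]
    refine Finset.sum_congr rfl fun R _ => ?_
    rw [Finset.sum_comm]
    refine Finset.sum_congr rfl fun S _ => ?_
    rw [Finset.sum_comm]
    refine Finset.sum_congr rfl fun T _ => Finset.sum_congr rfl fun V _ => by ring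
  rw [h₁, h₂]
  simp only [sum_wcoef_mul_wcoef]

lemma fmul_add (x y z : Finset (Fin n) → ℝ) : fmul x (y + z) = fmul x y + fmul x z := by
  funext I
  simp only [fmul, Pi.add_apply, mul_add, Finset.sum_add_distrib]

lemma add_fmul (x y z : Finset (Fin n) → ℝ) : fmul (x + y) z = fmul x z + fmul y z := by
  funext I
  simp only [fmul, Pi.add_apply, add_mul, mul_add, Finset.sum_add_distrib]

lemma fmul_smul (t : ℝ) (x y : Finset (Fin n) → ℝ) : fmul x (t • y) = t • fmul x y := by
  funext I
  simp only [fmul, Pi.smul_apply, smul_eq_mul, Finset.mul_sum]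
  exact Finset.sum_congr rfl fun R _ => Finset.sum_congr rfl fun S _ => by ring

lemma smul_fmul (t : ℝ) (x y : Finset (Fin n) → ℝ) : fmul (t • x) y = t • fmul x y := by
  funext I
  simp only [fmul, Pi.smul_apply, smul_eq_mul, Finset.mul_sum]
  exact Finset.sum_congr rfl fun R _ => Finset.sum_congr rfl fun S _ => by ring

lemma fmul_zero (x : Finset (Fin n) → ℝ) : fmul x 0 = 0 := by
  funext I; simp [fmul]

lemma flat_add {k : ℕ} (ω φ : Lam n k) : flat (ω + φ) = flat ω + flat φ := by
  funext S
  by_cases h : S.card = k <;> simp [flat, h]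

lemma flat_smul {k : ℕ} (t : ℝ) (ω : Lam n k) : flat (t • ω) = t • flat ω := by
  funext S
  by_cases h : S.card = k <;> simp [flat, h]

lemma flat_apply {k : ℕ} (ω : Lam n k) (I : Idx n k) : flat ω I.1 = ω I := by
  simp [flat, I.2]

lemma sum_flat_mul {k : ℕ} (ω : Lam n k) (G : Finset (Fin n) → ℝ) :
    ∑ R, flat ω R * G R = ∑ R : Idx n k, ω R * G R.1 := by
  have : ∑ R : Idx n k, ω R * G R.1 = ∑ R : Idx n k, flat ω R.1 * G R.1 :=
    Finset.sum_congr rfl fun R _ => by rw [flat_apply]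
  rw [this, ← Finset.sum_subtype (Finset.univ.filter fun R : Finset (Fin n) => R.card = k)
    (by simp) (fun R => flat ω R * G R)]
  symm
  refine Finset.sum_filter_of_ne fun R _ h => ?_
  by_contra hR
  simp [flat, hR] at h

lemma wedge_apply {k l m : ℕ} (ω : Lam n k) (φ : Lam n l) (I : Idx n m) :
    (wedge ω φ : Lam n m) I = fmul (flat ω) (flat φ) I.1 := by
  have h : fmul (flat ω) (flat φ) I.1 =
      ∑ R, flat ω R * ∑ S, flat φ S * wcoef R S I.1 := by
    simp only [fmul, Finset.mul_sum]
    exact Finset.sum_congr rfl fun R _ => Finset.sum_congr rfl fun S _ => by ring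
  rw [h, sum_flat_mul]
  simp only [sum_flat_mul, wedge, Finset.mul_sum]
  refine Finset.sum_congr rfl fun R _ => Finset.sum_congr rfl fun S _ => ?_
  unfold wcoef
  split_ifs <;> ring

lemma flat_wedge {k l m : ℕ} (h : k + l = m) (ω : Lam n k) (φ : Lam n l) :
    flat (wedge ω φ : Lam n m) = fmul (flat ω) (flat φ) := by
  funext I
  by_cases hI : I.card = m
  · rw [flat, dif_pos hI, wedge_apply]
  · rw [flat, dif_neg hI, fmul]
    symm
    refine Finset.sum_eq_zero fun R _ => Finset.sum_eq_zero fun S _ => ?_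
    by_cases hR : R.card = k
    · by_cases hS : S.card = l
      · rw [wcoef, if_neg, zero_mul]
        rintro ⟨rfl, hd⟩
        exact hI (by rw [Finset.card_union_of_disjoint hd, hR, hS, h])
      · simp [flat, hS]
    · simp [flat, hR]

lemma fmul_flat_one (a : Lam n 1) (x : Finset (Fin n) → ℝ) :
    fmul (flat a) x = fmul (invol x) (flat a) := by
  funext I
  rw [fmul, fmul, Finset.sum_comm]
  refine Finset.sum_congr rfl fun S _ => Finset.sum_congr rfl fun R _ => ?_
  by_cases hR : R.card = 1
  · by_cases hd : Disjoint R S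
    · simp only [wcoef, Finset.union_comm S R, disjoint_comm.1 hd, hd, and_true, invol]
      rw [msign_swap hd, hR, one_mul]
      split_ifs <;> ring
    · simp [wcoef, hd, disjoint_comm (a := S)]
  · simp [flat, hR]

lemma fmul_flat_one_self (a : Lam n 1) : fmul (flat a) (flat a) = 0 := by
  have h : invol (flat a) = (-1 : ℝ) • flat a := by
    funext S
    by_cases h : S.card = 1 <;> simp [invol, flat, h]
  have := fmul_flat_one a (flat a)
  rw [h, smul_fmul] at this
  funext I
  have := congrFun this I
  simp only [Pi.smul_apply, smul_eq_mul] at this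
  simp only [Pi.zero_apply]
  linarith

/-- Powers of an inhomogeneous form. -/
def fpow (x : Finset (Fin n) → ℝ) : ℕ → Finset (Fin n) → ℝ
  | 0 => fun I => if I = ∅ then 1 else 0
  | s + 1 => fmul x (fpow x s)

lemma flat_lpow {k : ℕ} (ω : Lam n k) (s : ℕ) : flat (lpow ω s) = fpow (flat ω) s := by
  induction s with
  | zero =>
    funext I
    by_cases h : I = ∅ <;> simp [lpow, fpow, flat, bform, h]
  | succ s ih =>
    rw [lpow, flat_wedge (by ring), ih, fpow]

lemma fmul_fmul_eq_zero (a : Lam n 1) (x : Finset (Fin n) → ℝ) {y : Finset (Fin n) → ℝ}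
    (hy : fmul (flat a) y = 0) : fmul (flat a) (fmul x y) = 0 := by
  rw [← fmul_assoc, fmul_flat_one, fmul_assoc, hy, fmul_zero]

lemma fpow_add_smul (x : Finset (Fin n) → ℝ) (a : Lam n 1) (b : Finset (Fin n) → ℝ) (s : ℕ) :
    ∃ y, fmul (flat a) y = 0 ∧
      ∀ t : ℝ, fpow (x + t • fmul (flat a) b) s = fpow x s + t • y := by
  induction s with
  | zero => exact ⟨0, fmul_zero _, fun t => by simp [fpow]⟩
  | succ s ih =>
    obtain ⟨y, hy, h⟩ := ih
    refine ⟨fmul x y + fmul (fmul (flat a) b) (fpow x s), ?_, fun t => ?_⟩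
    · rw [fmul_add, fmul_fmul_eq_zero a x hy, fmul_assoc, ← fmul_assoc, fmul_flat_one_self,
        zero_add]
      funext I; simp [fmul]
    · have : fmul (fmul (flat a) b) y = 0 := by
        rw [fmul_assoc, fmul_fmul_eq_zero a b hy]
      simp only [fpow]
      rw [h, add_fmul, fmul_add, fmul_add, smul_fmul, smul_fmul, fmul_smul, fmul_smul, this,
        smul_zero, smul_zero, add_zero, smul_add, add_assoc]

lemma isAffineLine_ip_lpow {k m : ℕ} (s : ℕ) (c : Lam n (m * s)) (h : 1 + k = m) (ω : Lam n m)
    (a : Lam n 1) (b : Lam n k) :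
    IsAffineLine fun t => ip c (lpow (ω + t • (wedge a b : Lam n m)) s) := by
  obtain ⟨y, -, hy⟩ := fpow_add_smul (flat ω) a (flat b) s
  refine .sum _ fun I _ => ⟨c I * fpow (flat ω) s I.1, c I * y I.1, fun t => ?_⟩
  simp only
  rw [← flat_apply (lpow _ s) I, flat_lpow, flat_add, flat_smul, flat_wedge h, hy]
  simp only [Pi.add_apply, Pi.smul_apply, smul_eq_mul]
  ring

end Flat

section Families

variable {n : ℕ}

/-- The sign of the product `e^{g 0} ∧ ⋯ ∧ e^{g (s-1)}`. -/
def famSign {s : ℕ} (g : Fin s → Finset (Fin n)) : ℝ :=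
  ∏ j, ∏ l, if j < l then msign (g j) (g l) else 1

open Classical in
/-- The coefficient of `e^K` in `e^{g 0} ∧ ⋯ ∧ e^{g (s-1)}`. -/
noncomputable def famCoef {s : ℕ} (g : Fin s → Finset (Fin n)) (K : Finset (Fin n)) : ℝ :=
  if Pairwise (Function.onFun Disjoint g) ∧ Finset.univ.biUnion g = K then famSign g else 0

lemma msign_biUnion {s : ℕ} (R : Finset (Fin n)) {g : Fin s → Finset (Fin n)}
    (hg : Pairwise (Function.onFun Disjoint g)) :
    msign R (Finset.univ.biUnion g) = ∏ l, msign R (g l) := by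
  rw [msign_eq_prod, Finset.prod_comm, Finset.prod_biUnion fun i _ j _ hij => hg hij]
  exact Finset.prod_congr rfl fun l _ => by rw [msign_eq_prod, Finset.prod_comm]

lemma famSign_cons {s : ℕ} (R : Finset (Fin n)) (g : Fin s → Finset (Fin n)) :
    famSign (Fin.cons R g : Fin (s + 1) → Finset (Fin n)) =
      (∏ l, msign R (g l)) * famSign g := by
  simp [famSign, Fin.prod_univ_succ]

lemma pairwise_disjoint_cons {s : ℕ} (R : Finset (Fin n)) (g : Fin s → Finset (Fin n)) :
    Pairwise (Function.onFun Disjoint (Fin.cons R g : Fin (s + 1) → Finset (Fin n))) ↔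
      Pairwise (Function.onFun Disjoint g) ∧ Disjoint R (Finset.univ.biUnion g) := by
  rw [Finset.disjoint_biUnion_right]
  constructor
  · intro h
    refine ⟨fun i j hij => ?_, fun i _ => ?_⟩
    · have := h (i := i.succ) (j := j.succ) (by simpa using hij)
      simpa [Function.onFun] using this
    · have := h (i := 0) (j := i.succ) (Fin.succ_ne_zero i).symm
      simpa [Function.onFun] using this
  · rintro ⟨h₁, h₂⟩ i j hij
    induction i using Fin.cases with
    | zero =>
      induction j using Fin.cases with
      | zero => exact absurd rfl hij
      | succ j => simpa [Function.onFun] using h₂ j (Finset.mem_univ j)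
    | succ i =>
      induction j using Fin.cases with
      | zero => simpa [Function.onFun] using (h₂ i (Finset.mem_univ i)).symm
      | succ j =>
        have := h₁ (i := i) (j := j) (by simpa using hij)
        simpa [Function.onFun] using this

lemma biUnion_cons {s : ℕ} (R : Finset (Fin n)) (g : Fin s → Finset (Fin n)) :
    Finset.univ.biUnion (Fin.cons R g : Fin (s + 1) → Finset (Fin n)) =
      R ∪ Finset.univ.biUnion g := by
  ext x
  simp [Fin.exists_fin_succ]

lemma famCoef_cons {s : ℕ} (R K : Finset (Fin n)) (g : Fin s → Finset (Fin n)) :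
    famCoef (Fin.cons R g : Fin (s + 1) → Finset (Fin n)) K =
      ∑ S, wcoef R S K * famCoef g S := by
  classical
  simp only [famCoef, pairwise_disjoint_cons, biUnion_cons, famSign_cons]
  by_cases hg : Pairwise (Function.onFun Disjoint g)
  · simp only [hg, true_and, mul_ite, mul_zero, Finset.sum_ite_eq, Finset.mem_univ, if_true,
      wcoef, ← msign_biUnion R hg, and_comm, ite_mul, zero_mul]
  · simp [hg]

/-- Expansion of the exterior power into products of basis forms. -/
lemma fpow_flat {k : ℕ} (ω : Lam n k) (s : ℕ) (K : Finset (Fin n)) :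
    fpow (flat ω) s K =
      ∑ g : Fin s → Idx n k, famCoef (fun j => (g j).1) K * ∏ j, ω (g j) := by
  induction s generalizing K with
  | zero =>
    simp only [fpow, famCoef, famSign]
    by_cases h : K = ∅
    · simp [h, Subsingleton.pairwise]
    · simp [h, Ne.symm h]
  | succ s ih =>
    rw [← (Fin.consEquiv fun _ : Fin (s + 1) => Idx n k).sum_comp, Fintype.sum_prod_type]
    have h₁ : fpow (flat ω) (s + 1) K =
        ∑ R, flat ω R * ∑ S, wcoef R S K * fpow (flat ω) s S := by
      simp only [fpow, fmul, Finset.mul_sum]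
      exact Finset.sum_congr rfl fun R _ => Finset.sum_congr rfl fun S _ => by ring
    rw [h₁, sum_flat_mul]
    refine Finset.sum_congr rfl fun R _ => ?_
    simp only [ih, Finset.mul_sum]
    rw [Finset.sum_comm]
    refine Finset.sum_congr rfl fun g _ => ?_
    have h₂ : (fun j => ((Fin.consEquiv fun _ : Fin (s + 1) => Idx n k) (R, g) j).1) =
        (Fin.cons R.1 fun j => (g j).1 : Fin (s + 1) → Finset (Fin n)) := by
      funext j
      induction j using Fin.cases <;> simp [Fin.consEquiv]
    rw [h₂, famCoef_cons, Fin.prod_univ_succ, Finset.sum_mul]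
    refine Finset.sum_congr rfl fun S _ => ?_
    simp only [Fin.consEquiv, Equiv.coe_fn_mk, Fin.cons_zero, Fin.cons_succ]
    ring

end Families

/-! ### Products with one-forms and the Hodge star -/

section OneForms

variable {n : ℕ}

lemma sum_idx_one (G : Idx n 1 → ℝ) :
    ∑ A, G A = ∑ i, G ⟨{i}, Finset.card_singleton i⟩ := by
  symm
  refine Function.Bijective.sum_comp (e := fun i : Fin n =>
    (⟨{i}, Finset.card_singleton i⟩ : Idx n 1)) ⟨fun i j h => ?_, fun A => ?_⟩ G
  · simpa using h
  · obtain ⟨i, hi⟩ := Finset.card_eq_one.1 A.2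
    exact ⟨i, Subtype.ext hi.symm⟩

lemma wedge_one_apply {k m : ℕ} (a : Lam n 1) (β : Lam n k) (I : Idx n m) :
    (wedge a β : Lam n m) I =
      ∑ i ∈ I.1, msign {i} (I.1.erase i) * (flat a {i} * flat β (I.1.erase i)) := by
  have h : fmul (flat a) (flat β) I.1 =
      ∑ R, flat a R * ∑ S, wcoef R S I.1 * flat β S := by
    simp only [fmul, Finset.mul_sum]
    exact Finset.sum_congr rfl fun R _ => Finset.sum_congr rfl fun S _ => by ring
  rw [wedge_apply, h, sum_flat_mul, sum_idx_one, ← Finset.sum_subset (Finset.subset_univ I.1)]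
  · refine Finset.sum_congr rfl fun i hi => ?_
    rw [Finset.sum_eq_single (I.1.erase i), wcoef, if_pos, ← flat_apply a]
    · ring
    · refine ⟨?_, by simp⟩
      rw [← Finset.insert_eq, Finset.insert_erase hi]
    · intro S _ hS
      rw [wcoef, if_neg, zero_mul]
      rintro ⟨h₁, h₂⟩
      rw [Finset.disjoint_singleton_left] at h₂
      rw [← h₁, ← Finset.insert_eq, Finset.erase_insert h₂] at hS
      exact hS rfl
    · simp
  · intro i _ hi
    rw [Finset.sum_eq_zero, mul_zero]
    intro S _
    rw [wcoef, if_neg, zero_mul]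
    rintro ⟨h₁, -⟩
    exact hi (h₁ ▸ by simp)

lemma iprod_one_apply {k m : ℕ} (a : Lam n 1) (b : Lam n k) (C : Idx n m) :
    (iprod a b : Lam n m) C =
      ∑ i ∈ C.1ᶜ, msign {i} C.1 * (flat a {i} * flat b (insert i C.1)) := by
  rw [iprod, sum_idx_one, ← Finset.sum_subset (Finset.subset_univ C.1ᶜ)]
  · refine Finset.sum_congr rfl fun i hi => ?_
    rw [Finset.mem_compl] at hi
    have h := sum_flat_mul b fun B =>
      if {i} ∪ C.1 = B then msign {i} C.1 * a ⟨{i}, Finset.card_singleton i⟩ else 0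
    rw [← flat_apply a] at h
    simp only [mul_ite, mul_zero, Finset.sum_ite_eq, Finset.mem_univ, if_true] at h
    rw [Finset.insert_eq]
    simp only [Finset.disjoint_singleton_left, hi, not_false_eq_true, and_true, ← flat_apply a]
    rw [show ∀ p q r : ℝ, p * (q * r) = r * (p * q) by intros; ring, h]
    refine Finset.sum_congr rfl fun B _ => ?_
    split_ifs <;> ring
  · intro i _ hi
    rw [Finset.mem_compl, not_not] at hi
    refine Finset.sum_eq_zero fun B _ => if_neg ?_
    rintro ⟨-, h⟩
    exact Finset.disjoint_singleton_left.1 h hi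

lemma hstar_apply {k m : ℕ} (ω : Lam n k) (J : Idx n m) :
    (hstar ω : Lam n m) J = msign J.1ᶜ J.1 * flat ω J.1ᶜ := by
  have h := sum_flat_mul ω fun I => if J.1ᶜ = I then msign I J.1 else 0
  simp only [mul_ite, mul_zero, Finset.sum_ite_eq, Finset.mem_univ, if_true] at h
  rw [mul_comm, h, hstar]
  refine Finset.sum_congr rfl fun I _ => ?_
  by_cases hI : I.1 = J.1ᶜ
  · rw [if_pos hI, if_pos hI.symm, mul_comm]
  · rw [if_neg hI, if_neg (Ne.symm hI)]

lemma flat_compl_hstar {k m : ℕ} (h : k + m = n) (ω : Lam n k) (S : Finset (Fin n)) :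
    flat (hstar ω : Lam n m) S = msign Sᶜ S * flat ω Sᶜ := by
  by_cases hS : S.card = m
  · rw [flat, dif_pos hS, hstar_apply]
  · rw [flat, dif_neg hS, flat, dif_neg, mul_zero]
    rw [Finset.card_compl, Fintype.card_fin]
    have := Finset.card_le_univ S
    rw [Fintype.card_fin] at this
    omega

lemma hstar_add_smul {k m : ℕ} (t : ℝ) (ω φ : Lam n k) :
    (hstar (ω + t • φ) : Lam n m) = hstar ω + t • hstar φ := by
  funext J
  simp only [hstar_apply, flat_add, flat_smul, Pi.add_apply, Pi.smul_apply, smul_eq_mul]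
  ring

/-- The inverse of the Hodge star. -/
def invStar {k m : ℕ} (ω : Lam n m) : Lam n k := fun I => msign I.1 I.1ᶜ * flat ω I.1ᶜ

lemma flat_invStar {k m : ℕ} (h : k + m = n) (ω : Lam n m) (S : Finset (Fin n)) :
    flat (invStar ω : Lam n k) S = msign S Sᶜ * flat ω Sᶜ := by
  by_cases hS : S.card = k
  · rw [flat, dif_pos hS, invStar]
  · rw [flat, dif_neg hS, flat, dif_neg, mul_zero]
    rw [Finset.card_compl, Fintype.card_fin]
    have := Finset.card_le_univ S
    rw [Fintype.card_fin] at this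
    omega

lemma hstar_invStar {k m : ℕ} (h : k + m = n) (ω : Lam n m) :
    (hstar (invStar ω : Lam n k) : Lam n m) = ω := by
  funext J
  rw [hstar_apply, flat_invStar h, compl_compl, ← mul_assoc, msign_mul_self, one_mul, flat_apply]

lemma invStar_hstar {k m : ℕ} (h : k + m = n) (ω : Lam n k) :
    (invStar (hstar ω : Lam n m) : Lam n k) = ω := by
  funext I
  rw [invStar, flat_compl_hstar h, compl_compl, ← mul_assoc, msign_mul_self, one_mul, flat_apply]

lemma invStar_add_smul {k m : ℕ} (t : ℝ) (ω φ : Lam n m) :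
    (invStar (ω + t • φ) : Lam n k) = invStar ω + t • invStar φ := by
  funext J
  simp only [invStar, flat_add, flat_smul, Pi.add_apply, Pi.smul_apply, smul_eq_mul]
  ring

lemma hstar_iprod {k l m p : ℕ} (hm : l + m = n) (hp : k + p = n) (a : Lam n 1) (b : Lam n k) :
    (hstar (iprod a b : Lam n l) : Lam n m) =
      (-1 : ℝ) ^ l • (wedge a (hstar b : Lam n p) : Lam n m) := by
  funext J
  have hJ : J.1ᶜ.card = l := by
    rw [Finset.card_compl, Fintype.card_fin, J.2]; omega
  rw [Pi.smul_apply, smul_eq_mul, hstar_apply, flat, dif_pos hJ, iprod_one_apply, compl_compl,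
    wedge_one_apply, Finset.mul_sum, Finset.mul_sum]
  refine Finset.sum_congr rfl fun i hi => ?_
  have hi' : i ∉ J.1ᶜ := by simpa using hi
  rw [flat_compl_hstar hp, Finset.compl_erase]
  have e₁ : msign J.1ᶜ J.1 = msign J.1ᶜ {i} * msign J.1ᶜ (J.1.erase i) := by
    rw [← msign_union_right _ (by simp), ← Finset.insert_eq, Finset.insert_erase hi]
  have e₂ : msign (insert i J.1ᶜ) (J.1.erase i) =
      msign {i} (J.1.erase i) * msign J.1ᶜ (J.1.erase i) := by
    rw [← msign_union_left _ (by simpa using hi), ← Finset.insert_eq]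
  have e₃ : msign {i} J.1ᶜ = (-1) ^ l * msign J.1ᶜ {i} := by
    rw [msign_swap (by simpa using hi), hJ, Finset.card_singleton, one_mul]
  have e₄ := msign_mul_self {i} (J.1.erase i)
  have e₅ := msign_mul_self J.1ᶜ {i}
  rw [e₁, e₂, e₃]
  linear_combination ((-1) ^ l * msign J.1ᶜ (J.1.erase i) * flat a {i} *
    flat b (insert i J.1ᶜ)) * (e₅ - e₄)

/-- The pairs `(a, β)` with `β` not involving the directions which occur in `a`. -/
def Separated {k : ℕ} (a : Lam n 1) (β : Lam n k) : Prop :=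
  ∀ (i : Fin n) (S : Finset (Fin n)), i ∈ S → flat a {i} * flat β S = 0

lemma Separated.iprod_eq_zero {k m : ℕ} {a : Lam n 1} {b : Lam n k} (h : Separated a b) :
    (iprod a b : Lam n m) = 0 := by
  funext C
  rw [iprod_one_apply]
  exact Finset.sum_eq_zero fun i _ => by rw [h i _ (Finset.mem_insert_self i _), mul_zero]

lemma Separated.wedge_invStar_eq_zero {k l m : ℕ} (hkl : k + l = n) {a : Lam n 1} {β : Lam n l}
    (h : Separated a β) : (wedge a (invStar β : Lam n k) : Lam n m) = 0 := by
  funext I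
  rw [wedge_one_apply]
  refine Finset.sum_eq_zero fun i _ => ?_
  have := h i (I.1.erase i)ᶜ (by simp)
  rw [flat_invStar hkl]
  linear_combination (msign {i} (I.1.erase i) * msign (I.1.erase i) (I.1.erase i)ᶜ) * this

end OneForms

/-! ### Coefficients of functions affine along exterior products -/

section Directions

variable {n : ℕ}

lemma wedge_add {k l m : ℕ} (a : Lam n k) (b b' : Lam n l) :
    (wedge a (b + b') : Lam n m) = wedge a b + wedge a b' := by
  funext I
  simp only [wedge_apply, flat_add, fmul_add, Pi.add_apply]

lemma add_wedge {k l m : ℕ} (a a' : Lam n k) (b : Lam n l) :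
    (wedge (a + a') b : Lam n m) = wedge a b + wedge a' b := by
  funext I
  simp only [wedge_apply, flat_add, add_fmul, Pi.add_apply]

lemma wedge_smul {k l m : ℕ} (t : ℝ) (a : Lam n k) (b : Lam n l) :
    (wedge a (t • b) : Lam n m) = t • wedge a b := by
  funext I
  simp only [wedge_apply, flat_smul, fmul_smul, Pi.smul_apply]

lemma flat_bform {k : ℕ} {S : Finset (Fin n)} (h : S.card = k) (T : Finset (Fin n)) :
    flat (bform S : Lam n k) T = if T = S then 1 else 0 := by
  by_cases hT : T = S
  · subst hT; simp [flat, bform, h]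
  · simp [flat, bform, hT]

lemma wedge_bform_singleton {k : ℕ} {i : Fin n} {S : Finset (Fin n)} (hi : i ∉ S)
    (hS : S.card = k) :
    (wedge (bform {i} : Lam n 1) (bform S : Lam n k) : Lam n (k + 1)) =
      msign {i} S • Pi.single ⟨insert i S, by rw [Finset.card_insert_of_notMem hi, hS]⟩ 1 := by
  funext I
  have h : ∀ R T, wcoef R T I.1 * (flat (bform {i} : Lam n 1) R * flat (bform S : Lam n k) T) =
      if R = {i} then if T = S then wcoef R T I.1 else 0 else 0 := by
    intro R T
    rw [flat_bform (Finset.card_singleton i), flat_bform hS]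
    split_ifs <;> simp
  rw [wedge_apply, fmul]
  simp only [h, Finset.sum_ite_irrel, Finset.sum_const_zero, Finset.sum_ite_eq', Finset.mem_univ,
    if_true]
  simp only [wcoef, Finset.disjoint_singleton_left, hi, not_false_eq_true, and_true,
    Pi.smul_apply, Pi.single_apply, smul_eq_mul, Subtype.ext_iff, ← Finset.insert_eq, mul_ite,
    mul_one, mul_zero, eq_comm (a := I.1)]

lemma separated_of_forall {k : ℕ} {a : Lam n 1} {β : Lam n k}
    (h : ∀ i, flat a {i} ≠ 0 → ∀ S, i ∈ S → flat β S = 0) : Separated a β := by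
  intro i S hi
  by_cases ha : flat a {i} = 0
  · rw [ha, zero_mul]
  · rw [h i ha S hi, mul_zero]

/-- `F` is affine along `a ∧ β` whenever `β` does not involve the directions in `a`. -/
def AffineAlongSeparated {k : ℕ} (F : Lam n (k + 1) → ℝ) : Prop :=
  ∀ (ω : Lam n (k + 1)) (a : Lam n 1) (β : Lam n k), Separated a β →
    IsAffineLine fun t => F (ω + t • (wedge a β : Lam n (k + 1)))

lemma wedge_bform_erase {k : ℕ} (I : Idx n (k + 1)) {i : Fin n} (hi : i ∈ I.1) :
    (wedge (bform {i} : Lam n 1) (msign {i} (I.1.erase i) • bform (I.1.erase i) : Lam n k) :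
      Lam n (k + 1)) = Pi.single I 1 := by
  rw [wedge_smul, wedge_bform_singleton (by simp) (by rw [Finset.card_erase_of_mem hi, I.2]; rfl),
    smul_smul, msign_mul_self, one_smul]
  congr 1
  exact Subtype.ext (Finset.insert_erase hi)

lemma flat_bform_erase_eq_zero {k : ℕ} (I : Idx n (k + 1)) {i : Fin n} (hi : i ∈ I.1)
    {S : Finset (Fin n)} (hS : i ∈ S) : flat (bform (I.1.erase i) : Lam n k) S = 0 := by
  rw [flat_bform (by rw [Finset.card_erase_of_mem hi, I.2]; rfl), if_neg]
  rintro rfl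
  simp at hS

lemma eq_of_flat_bform_ne_zero {i j : Fin n} (h : flat (bform {i} : Lam n 1) {j} ≠ 0) :
    j = i := by
  rw [flat_bform (Finset.card_singleton i)] at h
  simpa using h

lemma AffineAlongSeparated.single {k : ℕ} {F : Lam n (k + 1) → ℝ} (hF : AffineAlongSeparated F)
    (ω : Lam n (k + 1)) (I : Idx n (k + 1)) :
    IsAffineLine fun t => F (ω + t • Pi.single I 1) := by
  obtain ⟨i, hi⟩ := Finset.card_pos.1 (by rw [I.2]; omega : 0 < I.1.card)
  rw [← wedge_bform_erase I hi]
  refine hF _ _ _ (separated_of_forall fun j hj S hS => ?_)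
  obtain rfl := eq_of_flat_bform_ne_zero hj
  rw [flat_smul, Pi.smul_apply, flat_bform_erase_eq_zero I hi hS, smul_zero]

lemma AffineAlongSeparated.sepAffine {k : ℕ} {F : Lam n (k + 1) → ℝ}
    (hF : AffineAlongSeparated F) : SepAffine F :=
  sepAffine_of_isAffineLine hF.single

lemma AffineAlongSeparated.pdiff_pdiff_eq_zero {k : ℕ} {F : Lam n (k + 1) → ℝ}
    (hF : AffineAlongSeparated F) {I J : Idx n (k + 1)} (hIJ : ¬ Disjoint I.1 J.1) :
    pdiff (pdiff F J) I = 0 := by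
  obtain ⟨i, hi, hj⟩ := Finset.not_disjoint_iff.1 hIJ
  refine hF.sepAffine.pdiff_pdiff_eq_zero I J fun ω => ?_
  rw [← wedge_bform_erase I hi, ← wedge_bform_erase J hj, ← wedge_add]
  refine hF _ _ _ (separated_of_forall fun j hj' S hS => ?_)
  obtain rfl := eq_of_flat_bform_ne_zero hj'
  rw [flat_add, flat_smul, flat_smul, Pi.add_apply, Pi.smul_apply, Pi.smul_apply,
    flat_bform_erase_eq_zero I hi hS, flat_bform_erase_eq_zero J hj hS]
  simp

lemma AffineAlongSeparated.pdiff_exchange {k : ℕ} (hk : 1 ≤ k) {F : Lam n (k + 1) → ℝ}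
    (hF : AffineAlongSeparated F) {u v : Fin n} {P Q : Finset (Fin n)} {I J I' J' : Idx n (k + 1)}
    (hI : I.1 = insert u P) (hJ : J.1 = insert v Q) (hI' : I'.1 = insert v P)
    (hJ' : J'.1 = insert u Q) (huP : u ∉ P) (hvP : v ∉ P) (huQ : u ∉ Q) (hvQ : v ∉ Q)
    (hP : msign {u} P = msign {v} P) (hQ : msign {u} Q = msign {v} Q) (ω : Lam n (k + 1)) :
    pdiff (pdiff F J) I ω + pdiff (pdiff F J') I' ω = 0 := by
  have hPc : P.card = k := by
    have := I.2
    rw [hI, Finset.card_insert_of_notMem huP] at this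
    omega
  have hQc : Q.card = k := by
    have := J.2
    rw [hJ, Finset.card_insert_of_notMem hvQ] at this
    omega
  obtain ⟨x, hx⟩ := Finset.card_pos.1 (by omega : 0 < P.card)
  obtain ⟨y, hy⟩ := Finset.card_pos.1 (by omega : 0 < Q.card)
  refine hF.sepAffine.pdiff_pdiff_add_eq_zero I J I' J'
    (hF.pdiff_pdiff_eq_zero (Finset.not_disjoint_iff.2 ⟨x, by simp [hI, hx], by simp [hI', hx]⟩))
    (hF.pdiff_pdiff_eq_zero (Finset.not_disjoint_iff.2 ⟨u, by simp [hI], by simp [hJ']⟩))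
    (hF.pdiff_pdiff_eq_zero (Finset.not_disjoint_iff.2 ⟨v, by simp [hJ], by simp [hI']⟩))
    (hF.pdiff_pdiff_eq_zero (Finset.not_disjoint_iff.2 ⟨y, by simp [hJ, hy], by simp [hJ', hy]⟩))
    (fun x => ?_) ω
  have e : (wedge (bform {u} + bform {v} : Lam n 1)
      (msign {u} P • bform P + msign {u} Q • bform Q : Lam n k) : Lam n (k + 1)) =
      Pi.single I 1 + Pi.single J 1 + (Pi.single I' 1 + Pi.single J' 1) := by
    rw [add_wedge, wedge_add, wedge_add, wedge_smul, wedge_smul, wedge_smul, wedge_smul,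
      wedge_bform_singleton huP hPc, wedge_bform_singleton huQ hQc,
      wedge_bform_singleton hvP hPc, wedge_bform_singleton hvQ hQc, ← hP, ← hQ]
    simp only [smul_smul, msign_mul_self, one_smul]
    have h₁ := Subtype.ext (a1 := I) (a2 := ⟨insert u P, hI ▸ I.2⟩) hI
    have h₂ := Subtype.ext (a1 := J) (a2 := ⟨insert v Q, hJ ▸ J.2⟩) hJ
    have h₃ := Subtype.ext (a1 := I') (a2 := ⟨insert v P, hI' ▸ I'.2⟩) hI'
    have h₄ := Subtype.ext (a1 := J') (a2 := ⟨insert u Q, hJ' ▸ J'.2⟩) hJ'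
    rw [h₁, h₂, h₃, h₄]
    abel
  rw [← e]
  refine hF _ _ _ (separated_of_forall fun j hj S hS => ?_)
  have hj' : j = u ∨ j = v := by
    by_contra! hne
    refine hj ?_
    rw [flat_add, Pi.add_apply, flat_bform (Finset.card_singleton u),
      flat_bform (Finset.card_singleton v)]
    simp [hne.1, hne.2]
  have hSP : S ≠ P := by rintro rfl; rcases hj' with rfl | rfl <;> contradiction
  have hSQ : S ≠ Q := by rintro rfl; rcases hj' with rfl | rfl <;> contradiction
  rw [flat_add, flat_smul, flat_smul, Pi.add_apply, Pi.smul_apply, Pi.smul_apply, flat_bform hPc,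
    flat_bform hQc]
  simp [hSP, hSQ]

lemma AffineAlongSeparated.mcoef_eq_zero {k : ℕ} {F : Lam n (k + 1) → ℝ}
    (hF : AffineAlongSeparated F) {A : Finset (Idx n (k + 1))} {I J : Idx n (k + 1)}
    (hI : I ∈ A) (hJ : J ∈ A) (hne : I ≠ J) (hIJ : ¬ Disjoint I.1 J.1) : mcoef F A = 0 := by
  rw [← Finset.insert_erase hJ, mcoef_insert F (Finset.notMem_erase J A),
    ← Finset.insert_erase (Finset.mem_erase.2 ⟨hne, hI⟩),
    mcoef_insert _ (Finset.notMem_erase I _), hF.pdiff_pdiff_eq_zero hIJ]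
  simp [mcoef]

lemma AffineAlongSeparated.mcoef_exchange {k s : ℕ} (hk : 1 ≤ k) {F : Lam n (k + 1) → ℝ}
    (hF : AffineAlongSeparated F) {u v : Fin n} {P Q : Finset (Fin n)}
    {G G' : Fin s → Idx n (k + 1)} (hG : Function.Injective G) (hG' : Function.Injective G')
    {i j : Fin s} (hij : i ≠ j) (hGG' : ∀ l, l ≠ i → l ≠ j → G l = G' l)
    (hI : (G i).1 = insert u P) (hJ : (G j).1 = insert v Q) (hI' : (G' i).1 = insert v P)
    (hJ' : (G' j).1 = insert u Q) (huP : u ∉ P) (hvP : v ∉ P) (huQ : u ∉ Q) (hvQ : v ∉ Q)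
    (hP : msign {u} P = msign {v} P) (hQ : msign {u} Q = msign {v} Q) :
    mcoef F (Finset.univ.image G) + mcoef F (Finset.univ.image G') = 0 := by
  have key : ∀ H : Fin s → Idx n (k + 1), Function.Injective H →
      mcoef F (Finset.univ.image H) =
        mcoef (pdiff (pdiff F (H j)) (H i)) (((Finset.univ.erase j).erase i).image H) := by
    intro H hH
    rw [← mcoef_insert, ← mcoef_insert, ← Finset.image_insert, ← Finset.image_insert,
      Finset.insert_erase (by simp [hij]), Finset.insert_erase (by simp)]
    · rw [← Finset.image_insert, Finset.insert_erase (by simp [hij]), Finset.mem_image]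
      rintro ⟨l, hl, h⟩
      simp [hH h] at hl
    · rw [Finset.mem_image]
      rintro ⟨l, hl, h⟩
      simp [hH h] at hl
  have hB : ((Finset.univ.erase j).erase i).image G = ((Finset.univ.erase j).erase i).image G' := by
    refine Finset.image_congr fun l hl => ?_
    simp only [Finset.coe_erase, Set.mem_sdiff, Set.mem_singleton_iff] at hl
    exact hGG' l hl.2 hl.1.2
  rw [key G hG, key G' hG', hB, mcoef, mcoef, ← Finset.sum_add_distrib]
  refine Finset.sum_eq_zero fun B _ => ?_
  rw [← mul_add, hF.pdiff_exchange hk hI hJ hI' hJ' huP hvP huQ hvQ hP hQ, mul_zero]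

lemma AffineAlongSeparated.mul_card_le {k : ℕ} {F : Lam n (k + 1) → ℝ}
    (hF : AffineAlongSeparated F) {A : Finset (Idx n (k + 1))} (hA : mcoef F A ≠ 0) :
    A.card ≤ n / (k + 1) := by
  rw [Nat.le_div_iff_mul_le (Nat.succ_pos k)]
  have h : (A.biUnion fun I => I.1).card = ∑ I ∈ A, I.1.card := by
    refine Finset.card_biUnion fun I hI J hJ hne => ?_
    by_contra hIJ
    exact hA (hF.mcoef_eq_zero hI hJ hne hIJ)
  rw [Finset.sum_congr rfl fun I _ => I.2, Finset.sum_const, smul_eq_mul] at h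
  rw [← h]
  simpa using Finset.card_le_univ (A.biUnion fun I => I.1)

end Directions

/-! ### Labelings and signs -/

section Labelings

variable {N s : ℕ}

/-- The sign attached to the labeling `p`, counting inversions. -/
def labelSign (p : Fin N → Fin s) : ℝ :=
  ∏ x, ∏ y, if y < x ∧ p x < p y then (-1 : ℝ) else 1

lemma labelSign_comp_swap (p : Fin N → Fin s) {x₀ x₁ : Fin N} (h₀₁ : x₀ < x₁)
    (hadj : ∀ z, ¬(x₀ < z ∧ z < x₁)) (hp : p x₀ ≠ p x₁) :
    labelSign (p ∘ Equiv.swap x₀ x₁) = -labelSign p := by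
  set τ := Equiv.swap x₀ x₁ with hτ
  have hlt : ∀ x y, ¬(x = x₀ ∧ y = x₁) → ¬(x = x₁ ∧ y = x₀) → (τ y < τ x ↔ y < x) := by
    intro x y h₁ h₂
    have hx := hadj x
    have hy := hadj y
    simp only [hτ, Equiv.swap_apply_def]
    split_ifs <;> simp only [Fin.ext_iff, Fin.lt_def] at * <;> omega
  have h₁ : labelSign (p ∘ τ) = ∏ x, ∏ y, if τ y < τ x ∧ p x < p y then (-1 : ℝ) else 1 := by
    rw [labelSign, ← Equiv.prod_comp τ]
    refine Finset.prod_congr rfl fun x _ => ?_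
    rw [← Equiv.prod_comp τ]
    simp [hτ]
  obtain ⟨z, hz⟩ : ∃ z : Fin N × Fin N, ∀ x y,
      (if τ y < τ x ∧ p x < p y then (-1 : ℝ) else 1) =
        (if y < x ∧ p x < p y then (-1 : ℝ) else 1) * if (x, y) = z then -1 else 1 := by
    have hτ₀ : τ x₀ = x₁ := Equiv.swap_apply_left _ _
    have hτ₁ : τ x₁ = x₀ := Equiv.swap_apply_right _ _
    rcases lt_or_gt_of_ne hp with h | h
    · refine ⟨(x₀, x₁), fun x y => ?_⟩
      by_cases e₁ : x = x₀ ∧ y = x₁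
      · obtain ⟨rfl, rfl⟩ := e₁
        simp [hτ₀, hτ₁, h₀₁, h, h₀₁.le]
      · by_cases e₂ : x = x₁ ∧ y = x₀
        · obtain ⟨rfl, rfl⟩ := e₂
          simp [h.not_gt, h₀₁.ne']
        · rw [if_neg (c := (x, y) = (x₀, x₁)) (by simpa using e₁), mul_one]
          simp only [hlt x y e₁ e₂]
    · refine ⟨(x₁, x₀), fun x y => ?_⟩
      by_cases e₂ : x = x₁ ∧ y = x₀
      · obtain ⟨rfl, rfl⟩ := e₂
        simp [hτ₀, hτ₁, h₀₁, h, h₀₁.le]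
      · by_cases e₁ : x = x₀ ∧ y = x₁
        · obtain ⟨rfl, rfl⟩ := e₁
          simp [h.not_gt, h₀₁.ne]
        · rw [if_neg (c := (x, y) = (x₁, x₀)) (by simpa using e₂), mul_one]
          simp only [hlt x y e₁ e₂]
  rw [h₁]
  simp only [hz, Finset.prod_mul_distrib]
  rw [← labelSign]
  have h₂ : ∏ x, ∏ y, (if (x, y) = z then (-1 : ℝ) else 1) = -1 := by
    rw [← Fintype.prod_prod_type' (f := fun x y => if (x, y) = z then (-1 : ℝ) else 1)]
    simp
  rw [h₂]
  ring

lemma exists_perm_comp_eq {α β : Type*} [Fintype α] [DecidableEq β] {p q : α → β}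
    (h : ∀ l, (Finset.univ.filter fun x => p x = l).card =
      (Finset.univ.filter fun x => q x = l).card) : ∃ σ : Equiv.Perm α, q = p ∘ σ := by
  have e : ∀ l, Nonempty ({x // q x = l} ≃ {x // p x = l}) := fun l =>
    ⟨Fintype.equivOfCardEq (by rw [Fintype.card_subtype, Fintype.card_subtype, h])⟩
  replace e := fun l => (e l).some
  refine ⟨(Equiv.sigmaFiberEquiv q).symm.trans
    ((Equiv.sigmaCongrRight fun l => e l).trans (Equiv.sigmaFiberEquiv p)), funext fun x => ?_⟩
  exact ((e (q x)) ⟨x, rfl⟩).2.symm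

lemma eq_of_adjacent_swap_invariant {X : Type*} (P : (Fin N → Fin s) → Prop)
    (Φ : (Fin N → Fin s) → X) (hP : ∀ p, P p → ∀ σ : Equiv.Perm (Fin N), P (p ∘ σ))
    (h : ∀ p, P p → ∀ x₀ x₁ : Fin N, x₀ < x₁ → (∀ z, ¬(x₀ < z ∧ z < x₁)) →
      Φ (p ∘ Equiv.swap x₀ x₁) = Φ p) (p : Fin N → Fin s) (hp : P p)
    (σ : Equiv.Perm (Fin N)) : Φ (p ∘ σ) = Φ p := by
  cases N with
  | zero => rw [Subsingleton.elim (p ∘ σ) p]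
  | succ N =>
    have hσ : σ ∈ Submonoid.closure
        (Set.range fun i : Fin N => Equiv.swap i.castSucc i.succ) := by
      rw [Equiv.Perm.mclosure_swap_castSucc_succ]; trivial
    induction hσ using Submonoid.closure_induction generalizing p with
    | mem σ hσ =>
      obtain ⟨i, rfl⟩ := hσ
      refine h p hp _ _ Fin.castSucc_lt_succ fun z hz => ?_
      have h₁ := Fin.lt_def.1 hz.1
      have h₂ := Fin.lt_def.1 hz.2
      simp only [Fin.val_castSucc, Fin.val_succ] at h₁ h₂
      omega
    | one => rfl
    | mul σ τ _ _ h₁ h₂ =>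
      rw [Equiv.Perm.coe_mul, ← Function.comp_assoc, h₂ _ (hP p hp σ), h₁ p hp]

variable {n : ℕ}

/-- The block of label `l`, transported along `e`. -/
def block (e : Fin N ↪o Fin n) (p : Fin N → Fin s) (l : Fin s) : Finset (Fin n) :=
  (Finset.univ.filter fun x => p x = l).map e.toEmbedding

lemma mem_block {e : Fin N ↪o Fin n} {p : Fin N → Fin s} {l : Fin s} {x : Fin N} :
    e x ∈ block e p l ↔ p x = l := by
  simp [block]

lemma famSign_block (e : Fin N ↪o Fin n) (p : Fin N → Fin s) :
    famSign (block e p) = labelSign p := by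
  have h₁ : ∀ j l, (if j < l then msign (block e p j) (block e p l) else 1) =
      ∏ x with p x = j, ∏ y with p y = l, if y < x ∧ p x < p y then (-1 : ℝ) else 1 := by
    intro j l
    rw [msign_eq_prod, block, block, Finset.prod_map]
    simp only [Finset.prod_map, RelEmbedding.coe_toEmbedding, OrderEmbedding.lt_iff_lt]
    split_ifs with hjl
    · refine Finset.prod_congr rfl fun x hx => Finset.prod_congr rfl fun y hy => ?_
      rw [Finset.mem_filter] at hx hy
      simp [hx.2, hy.2, hjl]
    · symm
      refine Finset.prod_eq_one fun x hx => Finset.prod_eq_one fun y hy => ?_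
      rw [Finset.mem_filter] at hx hy
      simp [hx.2, hy.2, hjl]
  simp only [famSign, h₁, labelSign]
  rw [← Finset.prod_fiberwise (s := Finset.univ) (g := p)]
  refine Finset.prod_congr rfl fun j _ => ?_
  rw [Finset.prod_comm]
  refine Finset.prod_congr rfl fun x _ => ?_
  rw [← Finset.prod_fiberwise (s := Finset.univ) (g := p)]

end Labelings

/-! ### Independence of the coefficients of the decomposition -/

section Decomposition

variable {n N s : ℕ}

lemma card_block (e : Fin N ↪o Fin n) (p : Fin N → Fin s) (l : Fin s) :
    (block e p l).card = (Finset.univ.filter fun x => p x = l).card :=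
  Finset.card_map _

/-- The blocks of a labeling all of whose blocks have `m` elements. -/
def blockFam {m : ℕ} (e : Fin N ↪o Fin n) (p : Fin N → Fin s) (h : ∀ l, (block e p l).card = m)
    (l : Fin s) : Idx n m :=
  ⟨block e p l, h l⟩

lemma blockFam_injective {m : ℕ} (hm : 0 < m) (e : Fin N ↪o Fin n) (p : Fin N → Fin s)
    (h : ∀ l, (block e p l).card = m) : Function.Injective (blockFam e p h) := by
  intro l l' hl
  have hl' : block e p l = block e p l' := congrArg Subtype.val hl
  obtain ⟨y, hy⟩ := Finset.card_pos.1 (by rw [h l]; exact hm : 0 < (block e p l).card)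
  obtain ⟨x, hx, rfl⟩ := Finset.mem_map.1 hy
  have h₁ : p x = l := mem_block.1 hy
  rw [hl'] at hy
  exact h₁.symm.trans (mem_block.1 hy)

lemma AffineAlongSeparated.labelSign_mul_mcoef_swap {k : ℕ} (hk : 1 ≤ k)
    {F : Lam n (k + 1) → ℝ} (hF : AffineAlongSeparated F) (e : Fin N ↪o Fin n) (p : Fin N → Fin s)
    {x₀ x₁ : Fin N} (h₀₁ : x₀ < x₁) (hadj : ∀ z, ¬(x₀ < z ∧ z < x₁))
    (h : ∀ l, (block e p l).card = k + 1)
    (h' : ∀ l, (block e (p ∘ Equiv.swap x₀ x₁) l).card = k + 1) :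
    labelSign (p ∘ Equiv.swap x₀ x₁) *
        mcoef F (Finset.univ.image (blockFam e (p ∘ Equiv.swap x₀ x₁) h')) =
      labelSign p * mcoef F (Finset.univ.image (blockFam e p h)) := by
  by_cases hp : p x₀ = p x₁
  · have hq : p ∘ Equiv.swap x₀ x₁ = p := by
      funext x
      simp only [Function.comp_apply, Equiv.swap_apply_def]
      split_ifs with h₁ h₂
      · rw [h₁, hp]
      · rw [h₂, hp]
      · rfl
    have hfam : blockFam e (p ∘ Equiv.swap x₀ x₁) h' = blockFam e p h :=
      funext fun l => Subtype.ext (by simp only [blockFam, hq])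
    rw [hfam, hq]
  set rest : Fin s → Finset (Fin n) := fun l =>
    (Finset.univ.filter fun x => p x = l ∧ x ≠ x₀ ∧ x ≠ x₁).map e.toEmbedding with hrest
  have hne : x₀ ≠ x₁ := h₀₁.ne
  have hsign : ∀ l, msign {e x₀} (rest l) = msign {e x₁} (rest l) := by
    intro l
    simp only [msign_eq_prod, Finset.prod_singleton, hrest, Finset.prod_map,
      RelEmbedding.coe_toEmbedding, OrderEmbedding.lt_iff_lt]
    refine Finset.prod_congr rfl fun x hx => ?_
    have hx' := (Finset.mem_filter.1 hx).2.2
    have : x < x₀ ↔ x < x₁ := by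
      have := hadj x
      have h₁ := hx'.1
      have h₂ := hx'.2
      simp only [Fin.ext_iff, Fin.lt_def, ne_eq] at *
      omega
    simp only [this]
  have h₀ : ∀ l, e x₀ ∉ rest l := fun l => by simp [hrest]
  have h₁ : ∀ l, e x₁ ∉ rest l := fun l => by simp [hrest]
  have hblock : ∀ (q : Fin N → Fin s) (z : Fin N) (l : Fin s),
      (∀ x, q x = l ↔ x = z ∨ (p x = l ∧ x ≠ x₀ ∧ x ≠ x₁)) → block e q l = insert (e z) (rest l) := by
    intro q z l hq
    have : (Finset.univ.filter fun x => q x = l) =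
        insert z (Finset.univ.filter fun x => p x = l ∧ x ≠ x₀ ∧ x ≠ x₁) := by
      ext x
      simp [hq x]
    rw [block, this, Finset.map_insert]
    rfl
  have hexch := hF.mcoef_exchange hk (u := e x₀) (v := e x₁) (P := rest (p x₀))
    (Q := rest (p x₁)) (blockFam_injective k.succ_pos e p h)
    (blockFam_injective k.succ_pos e (p ∘ Equiv.swap x₀ x₁) h') hp (fun l hl hl' => ?_)
    (hblock _ _ _ fun x => ?_) (hblock _ _ _ fun x => ?_) (hblock _ _ _ fun x => ?_)
    (hblock _ _ _ fun x => ?_) (h₀ _) (h₁ _) (h₀ _) (h₁ _) (hsign _) (hsign _)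
  · rw [labelSign_comp_swap p h₀₁ hadj hp, eq_neg_of_add_eq_zero_right hexch]
    ring
  · refine Subtype.ext ?_
    refine congrArg (Finset.map _) (Finset.filter_congr fun x _ => ?_)
    simp only [Function.comp_apply, Equiv.swap_apply_def]
    split_ifs with h₂ h₃
    · subst h₂; simp [hl.symm, hl'.symm]
    · subst h₃; simp [hl.symm, hl'.symm]
    · rfl
  · rcases eq_or_ne x x₀ with rfl | hx₀
    · simp
    rcases eq_or_ne x x₁ with rfl | hx₁
    · simp [Ne.symm hp, hx₀]
    · simp [hx₀, hx₁]
  · rcases eq_or_ne x x₀ with rfl | hx₀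
    · simp [hp, hne]
    rcases eq_or_ne x x₁ with rfl | hx₁
    · simp
    · simp [hx₀, hx₁]
  · rcases eq_or_ne x x₀ with rfl | hx₀
    · simp [Ne.symm hp, hne]
    rcases eq_or_ne x x₁ with rfl | hx₁
    · simp
    · simp [hx₀, hx₁, Equiv.swap_apply_of_ne_of_ne]
  · rcases eq_or_ne x x₀ with rfl | hx₀
    · simp
    rcases eq_or_ne x x₁ with rfl | hx₁
    · simp [hp, hx₀]
    · simp [hx₀, hx₁, Equiv.swap_apply_of_ne_of_ne]

lemma AffineAlongSeparated.labelSign_mul_mcoef_eq {k : ℕ} (hk : 1 ≤ k)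
    {F : Lam n (k + 1) → ℝ} (hF : AffineAlongSeparated F) (e : Fin N ↪o Fin n)
    (p q : Fin N → Fin s) (hp : ∀ l, (block e p l).card = k + 1)
    (hq : ∀ l, (block e q l).card = k + 1) :
    labelSign p * mcoef F (Finset.univ.image (blockFam e p hp)) =
      labelSign q * mcoef F (Finset.univ.image (blockFam e q hq)) := by
  classical
  obtain ⟨σ, rfl⟩ := exists_perm_comp_eq (p := p) (q := q) fun l => by
    rw [← card_block e, ← card_block e, hp, hq]
  have hcomp : ∀ p : Fin N → Fin s, (∀ l, (block e p l).card = k + 1) →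
      ∀ τ : Equiv.Perm (Fin N), ∀ l, (block e (p ∘ τ) l).card = k + 1 := by
    intro p hp τ l
    rw [← hp l, card_block, card_block]
    refine Finset.card_bij (fun x _ => τ x) (by simp) (by simp) fun y hy => ⟨τ.symm y, ?_⟩
    simpa using hy
  have := eq_of_adjacent_swap_invariant (fun p => ∀ l, (block e p l).card = k + 1)
    (fun p => if h : ∀ l, (block e p l).card = k + 1 then
      labelSign p * mcoef F (Finset.univ.image (blockFam e p h)) else 0) hcomp
    (fun p hp x₀ x₁ h₀₁ hadj => ?_) p hp σ
  · rw [dif_pos hq, dif_pos hp] at this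
    exact this.symm
  · rw [dif_pos (hcomp p hp _), dif_pos hp]
    exact hF.labelSign_mul_mcoef_swap hk e p h₀₁ hadj hp _

lemma exists_block_eq {m : ℕ} {G : Fin s → Idx n m}
    (hG : Pairwise (Function.onFun Disjoint fun j => (G j).1)) {K : Finset (Fin n)}
    (hK : (Finset.univ.biUnion fun j => (G j).1) = K) :
    ∃ p : Fin K.card → Fin s, ∀ l, block (K.orderEmbOfFin rfl) p l = (G l).1 := by
  have : ∀ x : Fin K.card, ∃ l, K.orderEmbOfFin rfl x ∈ (G l).1 := fun x => by
    have := (Finset.ext_iff.1 hK _).2 (K.orderEmbOfFin_mem rfl x)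
    simpa using this
  choose p hp using this
  refine ⟨p, fun l => ?_⟩
  ext y
  constructor
  · intro hy
    obtain ⟨x, hx, rfl⟩ := Finset.mem_map.1 hy
    rw [← mem_block.1 hy]
    exact hp x
  · intro hy
    have hyK : y ∈ K := by
      rw [← hK]
      exact Finset.mem_biUnion.2 ⟨l, Finset.mem_univ l, hy⟩
    rw [← Finset.mem_coe, ← Finset.range_orderEmbOfFin K rfl] at hyK
    obtain ⟨x, rfl⟩ := hyK
    rw [mem_block]
    by_contra hne
    exact Finset.disjoint_left.1 (hG hne) (hp x) hy

lemma AffineAlongSeparated.famSign_mul_mcoef_eq {k : ℕ} (hk : 1 ≤ k)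
    {F : Lam n (k + 1) → ℝ} (hF : AffineAlongSeparated F) {G G' : Fin s → Idx n (k + 1)}
    (hG : Pairwise (Function.onFun Disjoint fun j => (G j).1))
    (hG' : Pairwise (Function.onFun Disjoint fun j => (G' j).1))
    (hK : (Finset.univ.biUnion fun j => (G j).1) = Finset.univ.biUnion fun j => (G' j).1) :
    famSign (fun j => (G j).1) * mcoef F (Finset.univ.image G) =
      famSign (fun j => (G' j).1) * mcoef F (Finset.univ.image G') := by
  obtain ⟨p, hp⟩ := exists_block_eq hG hK
  obtain ⟨q, hq⟩ := exists_block_eq hG' rfl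
  have hp' : ∀ l, (block _ p l).card = k + 1 := fun l => by rw [hp]; exact (G l).2
  have hq' : ∀ l, (block _ q l).card = k + 1 := fun l => by rw [hq]; exact (G' l).2
  have h₁ : G = blockFam _ p hp' := funext fun l => Subtype.ext (hp l).symm
  have h₂ : G' = blockFam _ q hq' := funext fun l => Subtype.ext (hq l).symm
  have := hF.labelSign_mul_mcoef_eq hk _ p q hp' hq'
  rw [← h₁, ← h₂, ← famSign_block, ← famSign_block, funext hp, funext hq] at this
  exact this

lemma famSign_mul_self (g : Fin s → Finset (Fin n)) : famSign g * famSign g = 1 := by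
  simp only [famSign, ← Finset.prod_mul_distrib]
  refine Finset.prod_eq_one fun j _ => Finset.prod_eq_one fun l _ => ?_
  split_ifs
  · exact msign_mul_self _ _
  · exact mul_one 1

lemma AffineAlongSeparated.exists_coeff {k : ℕ} (hk : 1 ≤ k) {F : Lam n (k + 1) → ℝ}
    (hF : AffineAlongSeparated F) (s : ℕ) : ∃ c : Finset (Fin n) → ℝ,
      ∀ G : Fin s → Idx n (k + 1), Function.Injective G → ∀ K,
        c K * famCoef (fun j => (G j).1) K =
          if Finset.univ.biUnion (fun j => (G j).1) = K then mcoef F (Finset.univ.image G)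
          else 0 := by
  classical
  have : ∀ K : Finset (Fin n), ∃ c : ℝ, ∀ G : Fin s → Idx n (k + 1), Function.Injective G →
      c * famCoef (fun j => (G j).1) K =
        if Finset.univ.biUnion (fun j => (G j).1) = K then mcoef F (Finset.univ.image G)
        else 0 := by
    intro K
    have hzero : ∀ G : Fin s → Idx n (k + 1), Function.Injective G →
        ¬Pairwise (Function.onFun Disjoint fun j => (G j).1) →
          mcoef F (Finset.univ.image G) = 0 := by
      intro G hG hdis
      simp only [Pairwise, not_forall] at hdis
      obtain ⟨i, j, hij, hdis⟩ := hdis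
      exact hF.mcoef_eq_zero (Finset.mem_image_of_mem G (Finset.mem_univ i))
        (Finset.mem_image_of_mem G (Finset.mem_univ j)) (hG.ne hij) hdis
    by_cases hex : ∃ G' : Fin s → Idx n (k + 1),
        Pairwise (Function.onFun Disjoint fun j => (G' j).1) ∧
          (Finset.univ.biUnion fun j => (G' j).1) = K
    · obtain ⟨G', hG', hK'⟩ := hex
      refine ⟨famSign (fun j => (G' j).1) * mcoef F (Finset.univ.image G'), fun G hinj => ?_⟩
      by_cases hG : Pairwise (Function.onFun Disjoint fun j => (G j).1)
      · simp only [famCoef, hG, true_and]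
        split_ifs with hK
        · rw [← hF.famSign_mul_mcoef_eq hk hG hG' (hK.trans hK'.symm), mul_right_comm,
            famSign_mul_self, one_mul]
        · rw [mul_zero]
      · simp [famCoef, hG, hzero G hinj hG]
    · refine ⟨0, fun G hinj => ?_⟩
      rw [zero_mul]
      split_ifs with hK
      · exact (hzero G hinj fun hG => hex ⟨G, hG, hK⟩).symm
      · rfl
  choose c hc using this
  exact ⟨c, fun G hG K => hc K G hG⟩

lemma AffineAlongSeparated.exists_ip_lpow_eq {k : ℕ} (hk : 1 ≤ k) {F : Lam n (k + 1) → ℝ}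
    (hF : AffineAlongSeparated F) (s : ℕ) : ∃ c : Lam n ((k + 1) * s), ∀ ω,
      ip c (lpow ω s) = ∑ A ∈ Finset.powersetCard s Finset.univ, mcoef F A * ∏ I ∈ A, ω I := by
  classical
  obtain ⟨c, hc⟩ := hF.exists_coeff hk s
  refine ⟨fun K => (s.factorial : ℝ)⁻¹ * c K.1, fun ω => ?_⟩
  have hdis : ∀ (G : Fin s → Idx n (k + 1)) (K : Finset (Fin n)), ¬Function.Injective G →
      famCoef (fun j => (G j).1) K = 0 := by
    intro G K hG
    rw [famCoef, if_neg]
    rintro ⟨h, -⟩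
    refine hG fun i j hij => by_contra fun hne => ?_
    have h₁ := h hne
    simp only [Function.onFun, hij, Finset.disjoint_self_iff_empty] at h₁
    have h₂ := (G j).2
    rw [h₁] at h₂
    simp at h₂
  have hterm : ∀ G : Fin s → Idx n (k + 1),
      ∑ K : Idx n ((k + 1) * s), c K.1 * famCoef (fun j => (G j).1) K.1 * ∏ j, ω (G j) =
        if Function.Injective G then
          mcoef F (Finset.univ.image G) * ∏ I ∈ Finset.univ.image G, ω I else 0 := by
    intro G
    by_cases hG : Function.Injective G
    · rw [if_pos hG, Finset.prod_image fun i _ j _ h => hG h, ← Finset.sum_mul]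
      congr 1
      simp only [hc G hG]
      by_cases hG' : Pairwise (Function.onFun Disjoint fun j => (G j).1)
      · have hcard : (Finset.univ.biUnion fun j => (G j).1).card = (k + 1) * s := by
          rw [Finset.card_biUnion fun i _ j _ hij => hG' hij,
            Finset.sum_congr rfl fun j _ => (G j).2]
          simp [mul_comm]
        rw [Finset.sum_eq_single ⟨_, hcard⟩]
        · simp
        · intro K _ hK
          rw [if_neg fun h => hK (Subtype.ext h.symm)]
        · simp
      · simp only [Pairwise, not_forall] at hG'
        obtain ⟨i, j, hij, hdis⟩ := hG'
        rw [hF.mcoef_eq_zero (Finset.mem_image_of_mem G (Finset.mem_univ i))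
          (Finset.mem_image_of_mem G (Finset.mem_univ j)) (hG.ne hij) hdis]
        simp
    · rw [if_neg hG]
      exact Finset.sum_eq_zero fun K _ => by rw [hdis G _ hG]; simp
  have hsum := sum_injective_image_eq s fun A : Finset (Idx n (k + 1)) =>
    mcoef F A * ∏ I ∈ A, ω I
  have hne : (s.factorial : ℝ) ≠ 0 := Nat.cast_ne_zero.2 s.factorial_ne_zero
  rw [← mul_right_inj' hne, ← hsum, ip]
  simp only [← flat_apply (lpow ω s), flat_lpow, fpow_flat, Finset.mul_sum]
  rw [Finset.sum_comm]
  refine Finset.sum_congr rfl fun G _ => ?_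
  refine Eq.trans (Finset.sum_congr rfl fun K _ => ?_) ((hterm G).trans (by congr))
  field_simp

theorem AffineAlongSeparated.exists_eq_sum {k : ℕ} (hk : 1 ≤ k) {F : Lam n (k + 1) → ℝ}
    (hF : AffineAlongSeparated F) : ∃ c : (s : ℕ) → Lam n ((k + 1) * s), ∀ ω,
      F ω = ∑ s ∈ Finset.range (n / (k + 1) + 1), ip (c s) (lpow ω s) := by
  classical
  choose c hc using hF.exists_ip_lpow_eq hk
  refine ⟨c, fun ω => ?_⟩
  rw [hF.sepAffine.eq_sum Finset.univ ω (by simp)]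
  have h : ∑ A ∈ (Finset.univ : Finset (Idx n (k + 1))).powerset, mcoef F A * ∏ I ∈ A, ω I =
      ∑ A with A.card ∈ Finset.range (n / (k + 1) + 1), mcoef F A * ∏ I ∈ A, ω I := by
    rw [Finset.powerset_univ]
    symm
    refine Finset.sum_subset (Finset.subset_univ _) fun A _ hA => ?_
    by_cases h : mcoef F A = 0
    · rw [h, zero_mul]
    · exact absurd (Nat.lt_succ_of_le (hF.mul_card_le h)) (by simpa using hA)
  rw [h, ← Finset.sum_fiberwise_of_maps_to (g := Finset.card)
    (t := Finset.range (n / (k + 1) + 1)) fun A hA => (Finset.mem_filter.1 hA).2]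
  refine Finset.sum_congr rfl fun s hs => ?_
  rw [hc]
  refine Finset.sum_congr ?_ fun _ _ => rfl
  ext A
  simp only [Finset.mem_filter, Finset.mem_univ, true_and, Finset.mem_powersetCard,
    Finset.subset_univ]
  exact ⟨fun h => h.2, fun h => ⟨h ▸ hs, h⟩⟩

end Decomposition

/-! ### Functions affine along exterior and interior products simultaneously -/

section ExtInt

variable {n : ℕ}

lemma iprod_add {k m : ℕ} (a : Lam n 1) (b b' : Lam n k) :
    (iprod a (b + b') : Lam n m) = iprod a b + iprod a b' := by
  funext C
  simp only [iprod_one_apply, flat_add, Pi.add_apply, mul_add, Finset.sum_add_distrib]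

lemma iprod_smul {k m : ℕ} (t : ℝ) (a : Lam n 1) (b : Lam n k) :
    (iprod a (t • b) : Lam n m) = t • iprod a b := by
  funext C
  simp only [iprod_one_apply, flat_smul, Pi.smul_apply, smul_eq_mul, Finset.mul_sum]
  exact Finset.sum_congr rfl fun i _ => by ring

lemma iprod_bform_insert {k m : ℕ} (J : Idx n m) {i : Fin n} (hi : i ∉ J.1) (hm : m + 1 = k) :
    (iprod (bform {i} : Lam n 1) (bform (insert i J.1) : Lam n k) : Lam n m) =
      msign {i} J.1 • Pi.single J 1 := by
  have hc : (insert i J.1).card = k := by rw [Finset.card_insert_of_notMem hi, J.2, hm]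
  funext C
  rw [iprod_one_apply, Pi.smul_apply, Pi.single_apply]
  have h : ∀ j, flat (bform {i} : Lam n 1) {j} = if j = i then 1 else 0 := fun j => by
    rw [flat_bform (Finset.card_singleton i)]
    simp
  by_cases hC : C = J
  · subst hC
    rw [Finset.sum_eq_single i]
    · simp [h, flat_bform hc]
    · intro j _ hj
      simp [h, hj]
    · simp [hi]
  · rw [if_neg hC, smul_zero]
    refine Finset.sum_eq_zero fun j hj => ?_
    rw [h, flat_bform hc]
    split_ifs with h₁ h₂
    · subst h₁
      refine absurd (Subtype.ext ?_) hC
      rw [← Finset.erase_insert hi, ← h₂, Finset.erase_insert (by simpa using hj)]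
    · ring
    · ring
    · ring

lemma wedge_bform_insert_eq_zero {k m : ℕ} (i : Fin n) {S : Finset (Fin n)}
    (hS : (insert i S).card = k) :
    (wedge (bform {i} : Lam n 1) (bform (insert i S) : Lam n k) : Lam n m) = 0 := by
  funext I
  rw [wedge_one_apply]
  refine Finset.sum_eq_zero fun j _ => ?_
  rw [flat_bform (Finset.card_singleton i), flat_bform hS]
  split_ifs with h₁ h₂
  · have hj : i ∈ I.1.erase j := h₂ ▸ Finset.mem_insert_self i S
    rw [Finset.singleton_inj.1 h₁] at hj
    simp at hj
  all_goals ring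

lemma iprod_bform_erase_eq_zero {k m : ℕ} (I : Idx n (k + 1)) {i : Fin n} (hi : i ∈ I.1) :
    (iprod (bform {i} : Lam n 1) (bform (I.1.erase i) : Lam n k) : Lam n m) = 0 := by
  refine Separated.iprod_eq_zero (separated_of_forall fun j hj S hS => ?_)
  obtain rfl := eq_of_flat_bform_ne_zero hj
  exact flat_bform_erase_eq_zero I hi hS

/-- A function of two variables which is affine in each coordinate and has no mixed terms
is a sum of functions of one variable. -/
lemma eq_add_of_isAffineLine {ι κ : Type*} [Fintype ι] [Fintype κ] [DecidableEq ι]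
    [DecidableEq κ] {f : (ι → ℝ) → (κ → ℝ) → ℝ} (h₁ : ∀ y, SepAffine fun x => f x y)
    (h₂ : ∀ x, SepAffine (f x))
    (h : ∀ (x : ι → ℝ) (y : κ → ℝ) (i : ι) (j : κ),
      IsAffineLine fun t => f (x + Pi.single i t) (y + Pi.single j t))
    (x : ι → ℝ) (y : κ → ℝ) : f x y = f x 0 + f 0 y - f 0 0 := by
  have hmix : ∀ (x : ι → ℝ) (y : κ → ℝ) (i : ι) (j : κ) (s t : ℝ),
      f (x + Pi.single i s) (y + Pi.single j t) -
      f (x + Pi.single i s) y = f x (y + Pi.single j t) - f x y := by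
    intro x y i j s t
    have key : ∀ s t : ℝ, f (x + Pi.single i s) (y + Pi.single j t) = f x y + s * (pdiff (f · y) i x)
        + t * pdiff (f x) j y +
        s * t * (pdiff (f (x + Pi.single i 1)) j y - pdiff (f x) j y) := by
      intro s t
      have e₁ := h₁ (y + Pi.single j t) x i s
      have e₂ := h₂ x y j t
      have e₃ := h₂ (x + Pi.single i 1) y j t
      simp only [pdiff] at *
      linear_combination e₁ + (1 - s) * e₂ + s * e₃
    have hr := (h x y i j).eq_zero_of_sq (p := f x y)
      (q := pdiff (f · y) i x + pdiff (f x) j y)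
      (r := pdiff (f (x + Pi.single i 1)) j y - pdiff (f x) j y) fun t => by
        rw [key]; ring
    have e₀ := key s 0
    have e₁ := key 0 t
    simp only [Pi.single_zero, add_zero] at e₀ e₁
    rw [key, e₀, e₁]
    linear_combination (s * t) * hr
  have hy : ∀ (y : κ → ℝ) (j : κ) (t : ℝ),
      f x (y + Pi.single j t) - f x y = f 0 (y + Pi.single j t) - f 0 y :=
    fun y j t => eq_apply_zero_of_single_invariant
      (h := fun x => f x (y + Pi.single j t) - f x y) (fun x i s => hmix x y i j s t) x
  have := eq_apply_zero_of_single_invariant (h := fun y => f x y - f 0 y)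
    (fun y j t => by linear_combination hy y j t) y
  linear_combination this

lemma smul_single_one {ι : Type*} [DecidableEq ι] (t : ℝ) (i : ι) :
    t • (Pi.single i 1 : ι → ℝ) = Pi.single i t := by
  rw [← Pi.single_smul', smul_eq_mul, mul_one]

end ExtInt

lemma hstar_smul {n k m : ℕ} (t : ℝ) (ω : Lam n k) :
    (hstar (t • ω) : Lam n m) = t • hstar ω := by
  have h₀ : (hstar (0 : Lam n k) : Lam n m) = 0 := by
    funext J
    simp [hstar]
  simpa [h₀] using hstar_add_smul (m := m) t 0 ω

section Main

variable {n k : ℕ} {f : Lam n (k + 1) → Lam n (k - 1) → ℝ}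

lemma ExtIntOneAffine.isAffineLine (hf : ExtIntOneAffine f) (ξ : Lam n (k + 1))
    (η : Lam n (k - 1)) (a : Lam n 1) (b : Lam n k) :
    IsAffineLine fun t =>
      f (ξ + t • (wedge a b : Lam n (k + 1))) (η + t • (iprod a b : Lam n (k - 1))) :=
  isAffineLine_of_convexOn (hf.1 ξ η a b) (hf.2 ξ η a b)

lemma ExtIntOneAffine.affineAlongSeparated_left (hf : ExtIntOneAffine f) (η : Lam n (k - 1)) :
    AffineAlongSeparated fun ξ => f ξ η := by
  intro ω a β h
  simpa [h.iprod_eq_zero] using hf.isAffineLine ω η a β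

lemma ExtIntOneAffine.affineAlongSeparated_right (hk : 1 ≤ k) (hkn : k ≤ n)
    (hf : ExtIntOneAffine f) (ξ : Lam n (k + 1)) :
    AffineAlongSeparated fun ζ : Lam n (n - k + 1) => f ξ (invStar ζ) := by
  intro ω a β h
  have h₁ : k - 1 + (n - k + 1) = n := by omega
  have h₂ : k + (n - k) = n := by omega
  have e : (iprod a ((-1 : ℝ) ^ (k - 1) • invStar β : Lam n k) : Lam n (k - 1)) =
      invStar (wedge a β : Lam n (n - k + 1)) := by
    rw [← invStar_hstar h₁ (iprod a _), iprod_smul, hstar_smul, hstar_iprod h₁ h₂,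
      hstar_invStar h₂, smul_smul, ← mul_pow]
    norm_num
  have := hf.isAffineLine ξ (invStar ω) a ((-1 : ℝ) ^ (k - 1) • invStar β)
  rw [wedge_smul, h.wedge_invStar_eq_zero h₂, e] at this
  simpa [invStar_add_smul] using this

lemma ExtIntOneAffine.isAffineLine_single_right (hk : 1 ≤ k) (hkn : k ≤ n)
    (hf : ExtIntOneAffine f) (ξ : Lam n (k + 1)) (η : Lam n (k - 1)) (J : Idx n (k - 1)) :
    IsAffineLine fun t => f ξ (η + t • Pi.single J 1) := by
  obtain ⟨i, hi⟩ : ∃ i, i ∉ J.1 := by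
    by_contra! h
    have := J.2
    rw [Finset.eq_univ_iff_forall.2 h, Finset.card_univ, Fintype.card_fin] at this
    omega
  have hc : (insert i J.1).card = k := by rw [Finset.card_insert_of_notMem hi, J.2]; omega
  have := hf.isAffineLine ξ η (bform {i}) (msign {i} J.1 • bform (insert i J.1))
  rw [wedge_smul, wedge_bform_insert_eq_zero i hc, iprod_smul,
    iprod_bform_insert J hi (by omega), smul_smul, msign_mul_self, one_smul] at this
  simpa using this

lemma ExtIntOneAffine.isAffineLine_single_single (hk : 1 ≤ k) (hf : ExtIntOneAffine f)
    (ξ : Lam n (k + 1)) (η : Lam n (k - 1)) (I : Idx n (k + 1)) (J : Idx n (k - 1)) :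
    IsAffineLine fun t => f (ξ + Pi.single I t) (η + Pi.single J t) := by
  obtain ⟨i, hI, hJ⟩ : ∃ i ∈ I.1, i ∉ J.1 :=
    Finset.exists_mem_notMem_of_card_lt_card (by rw [I.2, J.2]; omega)
  have hc : (insert i J.1).card = k := by rw [Finset.card_insert_of_notMem hJ, J.2]; omega
  have := hf.isAffineLine ξ η (bform {i})
    (msign {i} (I.1.erase i) • bform (I.1.erase i) + msign {i} J.1 • bform (insert i J.1))
  rw [wedge_add, wedge_bform_erase I hI, wedge_smul, wedge_bform_insert_eq_zero i hc, iprod_add,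
    iprod_smul, iprod_bform_erase_eq_zero I hI, iprod_smul, iprod_bform_insert J hJ (by omega),
    smul_smul, msign_mul_self, one_smul, smul_zero, smul_zero, add_zero, zero_add] at this
  simpa only [smul_single_one] using this

lemma ExtIntOneAffine.eq_add (hk : 1 ≤ k) (hkn : k ≤ n) (hf : ExtIntOneAffine f)
    (ξ : Lam n (k + 1)) (η : Lam n (k - 1)) : f ξ η = f ξ 0 + f 0 η - f 0 0 :=
  eq_add_of_isAffineLine (fun η => (hf.affineAlongSeparated_left η).sepAffine)
    (fun ξ => sepAffine_of_isAffineLine (hf.isAffineLine_single_right hk hkn ξ))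
    (hf.isAffineLine_single_single hk) ξ η

lemma isAffineLine_of_eq_sum (hk : 1 ≤ k) (hkn : k ≤ n) {c : (s : ℕ) → Lam n ((k + 1) * s)}
    {d : (r : ℕ) → Lam n ((n - k + 1) * r)} {p q : ℕ}
    (h : ∀ ξ η, f ξ η = (∑ s ∈ Finset.range p, ip (c s) (lpow ξ s)) +
      ∑ r ∈ Finset.range q, ip (d r) (lpow (hstar η : Lam n (n - k + 1)) r))
    (ξ : Lam n (k + 1)) (η : Lam n (k - 1)) (a : Lam n 1) (b : Lam n k) :
    IsAffineLine fun t =>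
      f (ξ + t • (wedge a b : Lam n (k + 1))) (η + t • (iprod a b : Lam n (k - 1))) := by
  have h₁ : k - 1 + (n - k + 1) = n := by omega
  have h₂ : k + (n - k) = n := by omega
  simp only [h, hstar_add_smul, hstar_iprod h₁ h₂]
  refine .add (.sum _ fun s _ => isAffineLine_ip_lpow s (c s) (by omega) ξ a b)
    (.sum _ fun r _ => ?_)
  have := isAffineLine_ip_lpow r (d r) (by omega) (hstar η) a
    ((-1 : ℝ) ^ (k - 1) • (hstar b : Lam n (n - k)))
  simpa only [wedge_smul] using this

end Main

/-- **Theorem (Characterization of ext-int. one affine functions, main formula).**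
Let `1 ≤ k ≤ n-1` and `f : Λ^{k+1} × Λ^{k-1} → ℝ`.  Then `f` is ext-int. one affine iff
there exist `c_s ∈ Λ^{(k+1)s}`, `0 ≤ s ≤ ⌊n/(k+1)⌋`, and `d_r ∈ Λ^{(n-k+1)r}`,
`0 ≤ r ≤ ⌊n/(n-k+1)⌋`, with
`f(ξ,η) = ∑_s ⟨c_s; ξ^s⟩ + ∑_r ⟨d_r; (∗η)^r⟩` for all `ξ, η`. -/
theorem stmt0 {n k : ℕ} (hk : 1 ≤ k) (hkn : k ≤ n - 1)
    (f : Lam n (k+1) → Lam n (k-1) → ℝ) :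
    ExtIntOneAffine f ↔
      ∃ (c : (s : ℕ) → Lam n ((k+1) * s)) (d : (r : ℕ) → Lam n ((n-k+1) * r)),
        ∀ (ξ : Lam n (k+1)) (η : Lam n (k-1)),
          f ξ η = (∑ s ∈ Finset.range (n / (k+1) + 1), ip (c s) (lpow ξ s))
            + ∑ r ∈ Finset.range (n / (n-k+1) + 1), ip (d r) (lpow (hstar η : Lam n (n-k+1)) r) := by
  constructor
  · intro hf
    obtain ⟨c, hc⟩ := (hf.affineAlongSeparated_left 0).exists_eq_sum hk
    have hη : AffineAlongSeparated fun ζ : Lam n (n - k + 1) => f 0 (invStar ζ) - f 0 0 :=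
      fun ω a β h => by
        have := hf.affineAlongSeparated_right hk (by omega) 0 ω a β h
        exact this.add (ψ := fun _ => -f 0 0) ⟨-f 0 0, 0, fun t => by ring⟩
    obtain ⟨d, hd⟩ := hη.exists_eq_sum (by omega)
    refine ⟨c, d, fun ξ η => ?_⟩
    rw [← hc, ← hd, invStar_hstar (by omega), hf.eq_add hk (by omega) ξ η]
    ring
  · rintro ⟨c, d, h⟩
    have hline := isAffineLine_of_eq_sum hk (by omega) h
    exact ⟨fun ξ η a b => (hline ξ η a b).convexOn,
      fun ξ η a b => (hline ξ η a b).neg.convexOn⟩
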